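/- Let n ≥ 1, K > 0, and let F : ℝⁿ → ℝ be a smooth function satisfying the special Lagrangian equation, i.e. λ₁(x) + λ₂(x) + … expressed as ∑ᵢ arctan λᵢ(x) = Θ for a constant Θ, where λ₁(x), …, λₙ(x) denote the (real) eigenvalues of the Hessian matrix D²F(x). Suppose that for every x ∈ ℝⁿ the eigenvalues satisfy λᵢ(x)·λⱼ(x) ≥ −1 for all i, j, and |λᵢ(x)| ≤ K for all i. Then D²F is constant; equivalently, F is a quadratic polynomial and the graph of ∇F is an affine subspace of ℝ²ⁿ. -/

import Mathlib

/-- The Hessian matrix of `F : ℝⁿ → ℝ` at `x`, with entries `∂²F/∂xⁱ∂xʲ (x)`. -/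
noncomputable def Hess (n : ℕ) (F : (Fin n → ℝ) → ℝ) (x : Fin n → ℝ) :
    Matrix (Fin n) (Fin n) ℝ :=
  fun i j => fderiv ℝ (fun y => fderiv ℝ F y (Pi.single j 1)) x (Pi.single i 1)

section specialLagrangian
open scoped ContDiff
open MeasureTheory

/-- Partial derivative in the `i`-th coordinate direction. -/
noncomputable def pd {n : ℕ} {V : Type*} [NormedAddCommGroup V] [NormedSpace ℝ V] (i : Fin n)
    (f : (Fin n → ℝ) → V) (x : Fin n → ℝ) : V := fderiv ℝ f x (Pi.single i 1)

/-- Entrywise partial derivative of a matrix-valued map. -/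
noncomputable def mpd {n : ℕ} {V : Type*} [NormedAddCommGroup V] [NormedSpace ℝ V] (k : Fin n)
    (M : (Fin n → ℝ) → Matrix (Fin n) (Fin n) V) (x : Fin n → ℝ) : Matrix (Fin n) (Fin n) V :=
  fun i j => pd k (fun y => M y i j) x

section pd
variable {n : ℕ} {V : Type*} [NormedAddCommGroup V] [NormedSpace ℝ V]
  {A : Type*} [NormedRing A] [NormedAlgebra ℝ A]

lemma contDiff_pd {f : (Fin n → ℝ) → V} (hf : ContDiff ℝ ∞ f) (i : Fin n) :
    ContDiff ℝ ∞ (pd i f) := by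
  unfold pd
  exact (hf.fderiv_right (m := ∞) (by simp)).clm_apply contDiff_const

lemma pd_add {f g : (Fin n → ℝ) → V} {x : Fin n → ℝ} (i : Fin n) (hf : DifferentiableAt ℝ f x)
    (hg : DifferentiableAt ℝ g x) : pd i (fun y => f y + g y) x = pd i f x + pd i g x := by
  simp [pd, fderiv_fun_add hf hg]

lemma pd_sub {f g : (Fin n → ℝ) → V} {x : Fin n → ℝ} (i : Fin n) (hf : DifferentiableAt ℝ f x)
    (hg : DifferentiableAt ℝ g x) : pd i (fun y => f y - g y) x = pd i f x - pd i g x := by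
  simp [pd, fderiv_fun_sub hf hg]

lemma pd_mul {f g : (Fin n → ℝ) → A} {x : Fin n → ℝ} (i : Fin n) (hf : DifferentiableAt ℝ f x)
    (hg : DifferentiableAt ℝ g x) :
    pd i (fun y => f y * g y) x = pd i f x * g x + f x * pd i g x := by
  simp [pd, fderiv_fun_mul' hf hg, add_comm]

lemma pd_sum {ι : Type*} (s : Finset ι) {f : ι → (Fin n → ℝ) → V} {x : Fin n → ℝ} (i : Fin n)
    (hf : ∀ a ∈ s, DifferentiableAt ℝ (f a) x) :
    pd i (fun y => ∑ a ∈ s, f a y) x = ∑ a ∈ s, pd i (f a) x := by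
  simp [pd, fderiv_fun_sum hf]

@[simp] lemma pd_const (c : V) (i : Fin n) (x : Fin n → ℝ) : pd i (fun _ => c) x = 0 := by
  simp [pd]

lemma pd_apply (i j : Fin n) (x : Fin n → ℝ) :
    pd i (fun y : Fin n → ℝ => y j) x = (1 : Matrix (Fin n) (Fin n) ℝ) i j := by
  have : HasFDerivAt (fun y : Fin n → ℝ => y j) (ContinuousLinearMap.proj (R := ℝ) j) x :=
    (ContinuousLinearMap.proj (R := ℝ) (φ := fun _ : Fin n => ℝ) j).hasFDerivAt
  rw [pd, this.fderiv]
  simp [Pi.single_apply, Matrix.one_apply, eq_comm]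

lemma pd_comp {f : (Fin n → ℝ) → ℝ} {φ : ℝ → V} {φ' : V} {x : Fin n → ℝ} (i : Fin n)
    (hφ : HasDerivAt φ φ' (f x)) (hf : DifferentiableAt ℝ f x) :
    pd i (fun y => φ (f y)) x = pd i f x • φ' := by
  have := (hφ.hasFDerivAt.comp x hf.hasFDerivAt).fderiv
  simp only [Function.comp_def] at this
  rw [pd, this]
  simp [pd]

lemma pd_comm {f : (Fin n → ℝ) → V} (hf : ContDiff ℝ ∞ f) (i j : Fin n) (x : Fin n → ℝ) :
    pd i (pd j f) x = pd j (pd i f) x := by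
  have h1 : Differentiable ℝ (fderiv ℝ f) :=
    (hf.fderiv_right (m := ∞) (by simp)).differentiable (by simp)
  have key (a b : Fin n) : pd a (pd b f) x
      = fderiv ℝ (fderiv ℝ f) x (Pi.single a 1) (Pi.single b 1) := by
    have : pd b f = fun y => fderiv ℝ f y (Pi.single b 1) := rfl
    rw [this, pd, fderiv_clm_apply (h1 x) (by fun_prop)]
    simp
  rw [key, key]
  have hs : IsSymmSndFDerivAt ℝ f x := hf.contDiffAt.isSymmSndFDerivAt
    (by simpa using WithTop.coe_le_coe.2 (le_top : (2 : ℕ∞) ≤ ⊤))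
  exact hs _ _

lemma pd_ofReal {f : (Fin n → ℝ) → ℝ} {x : Fin n → ℝ} (i : Fin n) (hf : DifferentiableAt ℝ f x) :
    pd i (fun y => (f y : ℂ)) x = ((pd i f x : ℝ) : ℂ) := by
  have : HasFDerivAt (fun y => (f y : ℂ)) (Complex.ofRealCLM.comp (fderiv ℝ f x)) x :=
    Complex.ofRealCLM.hasFDerivAt.comp x hf.hasFDerivAt
  rw [pd, this.fderiv]
  simp [pd]

lemma mpd_mul {M N : (Fin n → ℝ) → Matrix (Fin n) (Fin n) A} {x : Fin n → ℝ} (k : Fin n)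
    (hM : ∀ i j, DifferentiableAt ℝ (fun y => M y i j) x)
    (hN : ∀ i j, DifferentiableAt ℝ (fun y => N y i j) x) :
    mpd k (fun y => M y * N y) x = mpd k M x * N x + M x * mpd k N x := by
  ext i j
  simp only [mpd, Matrix.add_apply, Matrix.mul_apply]
  rw [pd_sum _ _ fun a _ => (hM i a).fun_mul (hN a j), ← Finset.sum_add_distrib]
  exact Finset.sum_congr rfl fun a _ => pd_mul k (hM i a) (hN a j)

lemma pd_trace {M : (Fin n → ℝ) → Matrix (Fin n) (Fin n) V} {x : Fin n → ℝ} (k : Fin n)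
    (hM : ∀ i j, DifferentiableAt ℝ (fun y => M y i j) x) :
    pd k (fun y => (M y).trace) x = (mpd k M x).trace := by
  simp only [Matrix.trace, Matrix.diag, mpd]
  exact pd_sum _ _ fun a _ => hM a a

end pd

section det
variable {n : ℕ} {A : Type*} [NormedField A] [NormedAlgebra ℝ A]

lemma contDiff_det {E : Type*} [NormedAddCommGroup E] [NormedSpace ℝ E] {r : WithTop ℕ∞}
    {M : E → Matrix (Fin n) (Fin n) A}
    (hM : ∀ i j, ContDiff ℝ r (fun y => M y i j)) : ContDiff ℝ r (fun y => (M y).det) := by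
  simp only [Matrix.det_apply']
  refine ContDiff.sum fun σ _ => contDiff_const.mul ?_
  exact contDiff_prod fun i _ => hM _ _

lemma pd_det {M : (Fin n → ℝ) → Matrix (Fin n) (Fin n) A} {x : Fin n → ℝ} (k : Fin n)
    (hM : ∀ i j, DifferentiableAt ℝ (fun y => M y i j) x) :
    pd k (fun y => (M y).det) x = ((M x).adjugate * mpd k M x).trace := by
  have h1 : pd k (fun y => (M y).det) x
      = ∑ i, ((M x).updateCol i (fun r => mpd k M x r i)).det := by
    have e : (fun y => (M y).det)
        = fun y => ∑ σ : Equiv.Perm (Fin n), (((Equiv.Perm.sign σ : ℤ) : A)) *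
          ∏ i, M y (σ i) i := by
      funext y; exact Matrix.det_apply' _
    have hp (σ : Equiv.Perm (Fin n)) : HasFDerivAt (fun y => ∏ i, M y (σ i) i)
        (∑ i, (∏ j ∈ Finset.univ.erase i, M x (σ j) j) •
          fderiv ℝ (fun y => M y (σ i) i) x) x :=
      HasFDerivAt.finsetProd fun i _ => (hM (σ i) i).hasFDerivAt
    rw [e, pd_sum _ _ fun σ _ => ((hp σ).differentiableAt.const_mul _)]
    simp only [Matrix.det_apply']
    rw [Finset.sum_comm]
    refine Finset.sum_congr rfl fun σ _ => ?_
    rw [pd_mul k (by fun_prop) (hp σ).differentiableAt, pd_const, zero_mul, zero_add, pd,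
      (hp σ).fderiv, ← Finset.mul_sum]
    congr 1
    simp only [sum_apply, smul_apply]
    refine Finset.sum_congr rfl fun i _ => ?_
    rw [← Finset.mul_prod_erase _ _ (Finset.mem_univ i), smul_eq_mul, mul_comm]
    congr 1
    · simp [mpd, pd]
    · refine Finset.prod_congr rfl fun j hj => ?_
      rw [Matrix.updateCol_ne (Finset.ne_of_mem_erase hj)]
  rw [h1, Matrix.trace]
  refine Finset.sum_congr rfl fun i _ => ?_
  rw [Matrix.diag_apply, Matrix.mul_apply, ← Matrix.cramer_apply, Matrix.cramer_eq_adjugate_mulVec]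
  rfl

end det

section matrix
variable {n : ℕ}

lemma det_one_add_smul_map {A : Matrix (Fin n) (Fin n) ℝ} (hA : A.IsHermitian) {c : ℂ}
    (hc : c ≠ 0) :
    (1 + c • A.map Complex.ofReal).det = ∏ i, (1 + c * (hA.eigenvalues i : ℂ)) := by
  have h1 : (1 + c • A.map Complex.ofReal : Matrix (Fin n) (Fin n) ℂ)
      = (-c) • (Matrix.scalar (Fin n) (-c⁻¹) - A.map Complex.ofRealHom) := by
    ext i j
    by_cases h : i = j
    · subst h
      simp [mul_sub, hc]
    · simp [h]
  have h2 : (A.map Complex.ofRealHom).charpoly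
      = (∏ i, (Polynomial.X - Polynomial.C (hA.eigenvalues i))).map Complex.ofRealHom := by
    rw [Matrix.charpoly_map]
    congr 1
    simpa using hA.charpoly_eq
  rw [h1, Matrix.det_smul, ← Matrix.eval_charpoly, h2, Polynomial.map_prod, Polynomial.eval_prod,
    Fintype.card_fin]
  rw [show (-c) ^ n = ∏ _i : Fin n, (-c) by simp, ← Finset.prod_mul_distrib]
  refine Finset.prod_congr rfl fun i _ => ?_
  simp
  field_simp
  ring

lemma det_one_add_sq {A : Matrix (Fin n) (Fin n) ℝ} (hA : A.IsHermitian) :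
    (1 + A * A).det = ∏ i, (1 + hA.eigenvalues i ^ 2) := by
  have h : ((1 + A * A).map Complex.ofRealHom : Matrix (Fin n) (Fin n) ℂ)
      = (1 + Complex.I • A.map Complex.ofReal) * (1 + (-Complex.I) • A.map Complex.ofReal) := by
    rw [Matrix.map_add _ (by simp), Matrix.map_mul, Matrix.map_one _ (by simp) (by simp)]
    simp only [mul_add, add_mul, mul_one, one_mul, Matrix.smul_mul, Matrix.mul_smul, smul_smul]
    have : (A.map Complex.ofReal) = A.map Complex.ofRealHom := rfl
    rw [this]
    simp
  have h2 := congrArg Matrix.det h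
  rw [Matrix.det_mul, det_one_add_smul_map hA Complex.I_ne_zero,
    det_one_add_smul_map hA (by simp), ← Finset.prod_mul_distrib, ← RingHom.mapMatrix_apply,
    ← RingHom.map_det] at h2
  apply Complex.ofReal_injective
  rw [← Complex.ofRealHom_eq_coe, h2, Complex.ofReal_prod]
  refine Finset.prod_congr rfl fun i _ => ?_
  push_cast
  ring_nf
  simp

lemma one_le_det_one_add_sq {A : Matrix (Fin n) (Fin n) ℝ} (hA : A.IsHermitian) :
    1 ≤ (1 + A * A).det := by
  rw [det_one_add_sq hA]
  exact Finset.prod_induction _ (fun x => 1 ≤ x) (fun a b => one_le_mul_of_one_le_of_one_le)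
    le_rfl fun i _ => by nlinarith [sq_nonneg (hA.eigenvalues i)]

lemma det_one_add_I_smul {A : Matrix (Fin n) (Fin n) ℝ} (hA : A.IsHermitian) :
    (1 + Complex.I • A.map Complex.ofReal).det
      = Complex.exp ((∑ i, Real.arctan (hA.eigenvalues i) : ℝ) * Complex.I)
        * (√((1 + A * A).det) : ℝ) := by
  have key (l : ℝ) : (1 + Complex.I * l : ℂ)
      = Complex.exp ((Real.arctan l : ℝ) * Complex.I) * (√(1 + l ^ 2) : ℝ) := by
    have hp : (0 : ℝ) < √(1 + l ^ 2) := Real.sqrt_pos.2 (by positivity)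
    rw [Complex.exp_mul_I, ← Complex.ofReal_cos, ← Complex.ofReal_sin, Real.cos_arctan,
      Real.sin_arctan]
    apply Complex.ext
    · simp [hp.ne']
    · simp [hp.ne']
  rw [det_one_add_smul_map hA Complex.I_ne_zero, det_one_add_sq hA, Finset.prod_congr rfl
    fun i _ => key (hA.eigenvalues i), Finset.prod_mul_distrib, ← Complex.exp_sum,
    ← Complex.ofReal_prod]
  congr 2
  · rw [Complex.ofReal_sum, Finset.sum_mul]
  · rw [Real.sqrt_prod _ fun i _ => by positivity]

/-- The contraction `∑ₖₗ Aₖₗ tr (B Tₗ C Tₖ)`. -/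
def cubic (A B C : Matrix (Fin n) (Fin n) ℝ) (T : Fin n → Matrix (Fin n) (Fin n) ℝ) : ℝ :=
  ∑ k, ∑ l, A k l * (B * T l * C * T k).trace

/-- The family `T` transformed by the change of basis `U`. -/
def rotate (U : Matrix (Fin n) (Fin n) ℝ) (T : Fin n → Matrix (Fin n) (Fin n) ℝ) (c : Fin n) :
    Matrix (Fin n) (Fin n) ℝ :=
  ∑ k, U k c • (U.transpose * T k * U)

lemma rotate_apply (U : Matrix (Fin n) (Fin n) ℝ) (T : Fin n → Matrix (Fin n) (Fin n) ℝ)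
    (c a b : Fin n) :
    rotate U T c a b = ∑ k, ∑ j, ∑ i, U k c * (U i a * T k i j * U j b) := by
  simp only [rotate, Matrix.sum_apply, Matrix.smul_apply, Matrix.mul_apply, smul_eq_mul,
    Matrix.transpose_apply, Finset.mul_sum, Finset.sum_mul]

lemma cubic_diagonal (U : Matrix (Fin n) (Fin n) ℝ) (α β γ : Fin n → ℝ)
    (T : Fin n → Matrix (Fin n) (Fin n) ℝ) :
    cubic (U * Matrix.diagonal α * U.transpose) (U * Matrix.diagonal β * U.transpose)
      (U * Matrix.diagonal γ * U.transpose) T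
      = ∑ c, ∑ a, ∑ b, α c * β a * γ b * (rotate U T c a b * rotate U T c b a) := by
  have h1 (k l : Fin n) : ((U * Matrix.diagonal β * U.transpose) * T l *
      (U * Matrix.diagonal γ * U.transpose) * T k).trace
      = (Matrix.diagonal β * (U.transpose * T l * U) *
        (Matrix.diagonal γ * (U.transpose * T k * U))).trace := by
    rw [show (U * Matrix.diagonal β * U.transpose) * T l *
      (U * Matrix.diagonal γ * U.transpose) * T k = U * (Matrix.diagonal β * (U.transpose * T l * U) *
        (Matrix.diagonal γ * (U.transpose * T k))) by simp only [Matrix.mul_assoc],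
      Matrix.trace_mul_comm]
    simp only [Matrix.mul_assoc]
  have h2 (c : Fin n) : (Matrix.diagonal β * rotate U T c *
      (Matrix.diagonal γ * rotate U T c)).trace
      = ∑ k, ∑ l, U k c * U l c * (Matrix.diagonal β * (U.transpose * T l * U) *
        (Matrix.diagonal γ * (U.transpose * T k * U))).trace := by
    simp only [rotate, Matrix.sum_mul, Matrix.trace_sum, Matrix.mul_smul,
      Matrix.smul_mul, Matrix.trace_smul, smul_eq_mul, mul_assoc, Finset.mul_sum]
  calc _ = ∑ c, α c * (Matrix.diagonal β * rotate U T c *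
      (Matrix.diagonal γ * rotate U T c)).trace := by
        simp only [h2, cubic, h1, Finset.mul_sum]
        rw [Finset.sum_comm]
        conv_rhs => rw [Finset.sum_comm]; enter [2, k]; rw [Finset.sum_comm]
        rw [Finset.sum_comm]
        refine Finset.sum_congr rfl fun k _ => Finset.sum_congr rfl fun l _ => ?_
        rw [Matrix.mul_apply, Finset.sum_mul]
        refine Finset.sum_congr rfl fun c _ => ?_
        rw [Matrix.mul_diagonal, Matrix.transpose_apply]
        ring
    _ = _ := by
        refine Finset.sum_congr rfl fun c _ => ?_
        rw [Matrix.trace, Finset.mul_sum]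
        refine Finset.sum_congr rfl fun a _ => ?_
        rw [Matrix.diag_apply, Matrix.mul_apply, Finset.mul_sum]
        refine Finset.sum_congr rfl fun b _ => ?_
        rw [Matrix.diagonal_mul, Matrix.diagonal_mul]
        ring

lemma rotate_swap_left (U : Matrix (Fin n) (Fin n) ℝ) {T : Fin n → Matrix (Fin n) (Fin n) ℝ}
    (hT : ∀ i j k, T i j k = T j i k) (c a b : Fin n) : rotate U T c a b = rotate U T a c b := by
  rw [rotate_apply, rotate_apply, Finset.sum_comm]
  conv_lhs => enter [2, j]; rw [Finset.sum_comm]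
  rw [Finset.sum_comm]
  refine Finset.sum_congr rfl fun k _ => Finset.sum_congr rfl fun j _ =>
    Finset.sum_congr rfl fun i _ => ?_
  rw [hT]
  ring

lemma rotate_swap_right (U : Matrix (Fin n) (Fin n) ℝ) {T : Fin n → Matrix (Fin n) (Fin n) ℝ}
    (hT : ∀ i j k, T i j k = T i k j) (c a b : Fin n) : rotate U T c a b = rotate U T c b a := by
  rw [rotate_apply, rotate_apply]
  refine Finset.sum_congr rfl fun k _ => ?_
  rw [Finset.sum_comm]
  refine Finset.sum_congr rfl fun j _ => Finset.sum_congr rfl fun i _ => ?_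
  rw [hT]
  ring

lemma le_cubic {A : Matrix (Fin n) (Fin n) ℝ} (hA : A.IsHermitian) {K : ℝ}
    (hprod : ∀ i j, -1 ≤ hA.eigenvalues i * hA.eigenvalues j)
    (hbdd : ∀ i, |hA.eigenvalues i| ≤ K)
    {T : Fin n → Matrix (Fin n) (Fin n) ℝ}
    (hT : ∀ i j k, T i j k = T j i k) (hT' : ∀ i j k, T i j k = T i k j)
    {G S : Matrix (Fin n) (Fin n) ℝ} (hG : G = (1 + A * A)⁻¹) (hS : S = A * G) :
    (1 / 3) * (1 / (1 + K ^ 2)) ^ 3 * ∑ k, ∑ i, ∑ j, T k i j ^ 2 ≤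
      cubic G G G T - cubic G S S T + cubic S S G T + cubic S G S T := by
  set l := hA.eigenvalues with hl
  set g : Fin n → ℝ := fun i => 1 / (1 + l i ^ 2) with hg
  have gpos (i) : 0 < 1 + l i ^ 2 := by positivity
  obtain ⟨U, hU, hU', hAU⟩ : ∃ U : Matrix (Fin n) (Fin n) ℝ, U * U.transpose = 1 ∧
      U.transpose * U = 1 ∧ A = U * Matrix.diagonal l * U.transpose := by
    refine ⟨hA.eigenvectorUnitary, ?_, ?_, ?_⟩
    · exact Unitary.coe_mul_star_self hA.eigenvectorUnitary
    · exact Unitary.coe_star_mul_self hA.eigenvectorUnitary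
    · conv_lhs => rw [hA.spectral_theorem]
      rfl
  have conj_mul (α β : Fin n → ℝ) : (U * Matrix.diagonal α * U.transpose) *
      (U * Matrix.diagonal β * U.transpose)
      = U * Matrix.diagonal (fun i => α i * β i) * U.transpose := by
    rw [← Matrix.diagonal_mul_diagonal]
    calc _ = U * Matrix.diagonal α * (U.transpose * U) * Matrix.diagonal β * U.transpose := by
            simp only [Matrix.mul_assoc]
      _ = _ := by rw [hU']; simp only [Matrix.mul_assoc, Matrix.one_mul]
  have conj_one : U * Matrix.diagonal (fun _ => 1) * U.transpose = 1 := by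
    rw [Matrix.diagonal_one, Matrix.mul_one, hU]
  have hGU : G = U * Matrix.diagonal g * U.transpose := by
    rw [hG]
    apply Matrix.inv_eq_right_inv
    rw [hAU, conj_mul]
    nth_rw 1 [← conj_one]
    rw [← Matrix.add_mul, ← Matrix.mul_add, Matrix.diagonal_add, conj_mul, ← conj_one]
    congr 3
    funext i
    simp only [hg]
    have := gpos i
    field_simp
  have hSU : S = U * Matrix.diagonal (fun i => l i * g i) * U.transpose := by
    rw [hS, hAU, hGU, conj_mul]
  set R := rotate U T with hR
  have R1 (c a b) : R c a b = R a c b := rotate_swap_left U hT c a b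
  have R2 (c a b) : R c a b = R c b a := rotate_swap_right U hT' c a b
  have hTR : ∑ k, ∑ i, ∑ j, T k i j ^ 2 = ∑ c, ∑ a, ∑ b, R c a b ^ 2 := by
    have h := cubic_diagonal U (fun _ => 1) (fun _ => 1) (fun _ => 1) T
    rw [conj_one] at h
    have h' : cubic 1 1 1 T = ∑ k, ∑ i, ∑ j, T k i j ^ 2 := by
      simp only [cubic, Matrix.one_apply, Matrix.mul_one, ite_mul, one_mul,
        zero_mul, Finset.sum_ite_eq, Finset.mem_univ, if_true, Matrix.trace, Matrix.diag_apply,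
        Matrix.mul_apply]
      refine Finset.sum_congr rfl fun k _ => Finset.sum_congr rfl fun i _ =>
        Finset.sum_congr rfl fun j _ => ?_
      rw [hT' k j i, sq]
    rw [← h', h]
    refine Finset.sum_congr rfl fun k _ => Finset.sum_congr rfl fun i _ =>
        Finset.sum_congr rfl fun j _ => ?_
    rw [← hR, R2 k j i]
    ring
  set W : Fin n → Fin n → Fin n → ℝ := fun c a b => g c * g a * g b * R c a b ^ 2 with hW
  have W1 (c a b) : W c a b = W a c b := by simp only [hW]; rw [R1]; ring
  have W2 (c a b) : W c a b = W c b a := by simp only [hW]; rw [R2]; ring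
  have e1 : ∑ c, ∑ a, ∑ b, l c * l a * W c a b = ∑ c, ∑ a, ∑ b, l a * l b * W c a b := by
    conv_lhs => enter [2, c]; rw [Finset.sum_comm]
    rw [Finset.sum_comm]
    refine Finset.sum_congr rfl fun c _ => Finset.sum_congr rfl fun a _ =>
        Finset.sum_congr rfl fun b _ => ?_
    rw [W2, W1]
  have e2 : ∑ c, ∑ a, ∑ b, l c * l b * W c a b = ∑ c, ∑ a, ∑ b, l a * l b * W c a b := by
    rw [Finset.sum_comm]
    refine Finset.sum_congr rfl fun c _ => Finset.sum_congr rfl fun a _ =>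
        Finset.sum_congr rfl fun b _ => ?_
    rw [W1]
  have key : cubic G G G T - cubic G S S T + cubic S S G T + cubic S G S T
      = ∑ c, ∑ a, ∑ b, (1 / 3) * (3 + l c * l a + l c * l b + l a * l b) * W c a b := by
    have : cubic G G G T - cubic G S S T + cubic S S G T + cubic S G S T
        = ∑ c, ∑ a, ∑ b, (W c a b - l a * l b * W c a b + l c * l a * W c a b
          + l c * l b * W c a b) := by
      rw [hSU, hGU]
      simp only [cubic_diagonal, ← Finset.sum_sub_distrib, ← Finset.sum_add_distrib]
      refine Finset.sum_congr rfl fun c _ => Finset.sum_congr rfl fun a _ =>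
        Finset.sum_congr rfl fun b _ => ?_
      rw [← hR, R2 c b a]
      simp only [hW]
      ring
    rw [this]
    have e3 : ∑ c, ∑ a, ∑ b, (1 / 3) * (3 + l c * l a + l c * l b + l a * l b) * W c a b
        = ∑ c, ∑ a, ∑ b, W c a b + (1 / 3) * ∑ c, ∑ a, ∑ b, l c * l a * W c a b
          + (1 / 3) * ∑ c, ∑ a, ∑ b, l c * l b * W c a b
          + (1 / 3) * ∑ c, ∑ a, ∑ b, l a * l b * W c a b := by
      simp only [Finset.mul_sum, ← Finset.sum_add_distrib]
      refine Finset.sum_congr rfl fun c _ => Finset.sum_congr rfl fun a _ =>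
        Finset.sum_congr rfl fun b _ => ?_
      ring
    rw [e3, e1, e2]
    simp only [Finset.sum_add_distrib, Finset.sum_sub_distrib]
    rw [e1, e2]
    ring
  rw [key, hTR, Finset.mul_sum]
  simp only [Finset.mul_sum]
  refine Finset.sum_le_sum fun c _ => Finset.sum_le_sum fun a _ => Finset.sum_le_sum fun b _ => ?_
  have h3 : 1 ≤ 3 + l c * l a + l c * l b + l a * l b := by
    have p1 := hprod c a
    have p2 := hprod c b
    have p3 := hprod a b
    rcases le_total 0 (l c) with h1 | h1 <;> rcases le_total 0 (l a) with h2 | h2 <;>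
      rcases le_total 0 (l b) with h4 | h4
    · nlinarith [mul_nonneg h1 h2]
    · nlinarith [mul_nonneg h1 h2]
    · nlinarith [mul_nonneg h1 h4]
    · nlinarith [mul_nonneg_of_nonpos_of_nonpos h2 h4]
    · nlinarith [mul_nonneg h2 h4]
    · nlinarith [mul_nonneg_of_nonpos_of_nonpos h1 h4]
    · nlinarith [mul_nonneg_of_nonpos_of_nonpos h1 h2]
    · nlinarith [mul_nonneg_of_nonpos_of_nonpos h1 h2]
  have hK (i) : 1 / (1 + K ^ 2) ≤ g i := by
    have : l i ^ 2 ≤ K ^ 2 := sq_le_sq' (abs_le.1 (hbdd i)).1 (abs_le.1 (hbdd i)).2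
    exact one_div_le_one_div_of_le (gpos i) (by linarith)
  have g0 (i) : 0 ≤ g i := by have := gpos i; positivity
  have hK0 : (0 : ℝ) ≤ 1 / (1 + K ^ 2) := by positivity
  have hggg : (1 / (1 + K ^ 2)) ^ 3 ≤ g c * g a * g b := by
    rw [pow_three']
    exact mul_le_mul (mul_le_mul (hK c) (hK a) hK0 (g0 c)) (hK b) hK0 (mul_nonneg (g0 c) (g0 a))
  have hWn : (1 / (1 + K ^ 2)) ^ 3 * R c a b ^ 2 ≤ W c a b :=
    mul_le_mul_of_nonneg_right hggg (sq_nonneg _)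
  have hW0 : 0 ≤ W c a b := le_trans (by positivity) hWn
  nlinarith

end matrix

section sl
variable {n : ℕ}

/-- Inverse of the metric induced on the graph of `∇F`. -/
noncomputable def invMetric (F : (Fin n → ℝ) → ℝ) (x : Fin n → ℝ) : Matrix (Fin n) (Fin n) ℝ :=
  (1 + Hess n F x * Hess n F x)⁻¹

/-- Volume density of the graph of `∇F`. -/
noncomputable def volDensity (F : (Fin n → ℝ) → ℝ) (x : Fin n → ℝ) : ℝ :=
  √((1 + Hess n F x * Hess n F x).det)

/-- The graph of `∇F` has constant phase. -/
def ConstPhase (F : (Fin n → ℝ) → ℝ) : Prop :=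
  ∃ Θ : ℝ, ∀ x, (1 + Complex.I • (Hess n F x).map Complex.ofReal).det
    = Complex.exp (Θ * Complex.I) * (volDensity F x : ℝ)

/-- `√g` times the Laplacian of the graph of `∇F`, in nondivergence form. -/
noncomputable def lap (F f : (Fin n → ℝ) → ℝ) (x : Fin n → ℝ) : ℝ :=
  ∑ i, ∑ j, volDensity F x * invMetric F x i j * pd i (pd j f) x

variable {F : (Fin n → ℝ) → ℝ} (hF : ContDiff ℝ ∞ F)
include hF

lemma Hess_comm (x : Fin n → ℝ) (i j : Fin n) : Hess n F x i j = Hess n F x j i :=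
  pd_comm hF i j x

lemma Hess_isHermitian (x : Fin n → ℝ) : (Hess n F x).IsHermitian := by
  ext i j
  simp [Hess_comm hF x j i]

lemma Hess_transpose (x : Fin n → ℝ) : (Hess n F x).transpose = Hess n F x := by
  ext i j
  simp [Hess_comm hF x j i]

lemma contDiff_Hess (i j : Fin n) : ContDiff ℝ ∞ (fun x => Hess n F x i j) :=
  contDiff_pd (contDiff_pd hF j) i

lemma contDiff_one_add_sq (i j : Fin n) :
    ContDiff ℝ ∞ (fun x => (1 + Hess n F x * Hess n F x) i j) := by
  simp only [Matrix.add_apply, Matrix.mul_apply]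
  exact contDiff_const.add
    (ContDiff.sum fun k _ => (contDiff_Hess hF i k).mul (contDiff_Hess hF k j))

lemma one_le_det (x : Fin n → ℝ) : 1 ≤ (1 + Hess n F x * Hess n F x).det :=
  one_le_det_one_add_sq (Hess_isHermitian hF x)

lemma one_le_volDensity (x : Fin n → ℝ) : 1 ≤ volDensity F x :=
  Real.one_le_sqrt.2 (one_le_det hF x)

lemma volDensity_pos (x : Fin n → ℝ) : 0 < volDensity F x :=
  zero_lt_one.trans_le (one_le_volDensity hF x)

lemma contDiff_volDensity : ContDiff ℝ ∞ (volDensity F) :=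
  (contDiff_det (contDiff_one_add_sq hF)).sqrt
    fun x => (zero_lt_one.trans_le (one_le_det hF x)).ne'

lemma contDiff_invMetric (i j : Fin n) : ContDiff ℝ ∞ (fun x => invMetric F x i j) := by
  simp only [invMetric, Matrix.inv_def, Matrix.smul_apply, Ring.inverse_eq_inv', smul_eq_mul]
  refine ((contDiff_det (contDiff_one_add_sq hF)).inv
    fun x => (zero_lt_one.trans_le (one_le_det hF x)).ne').mul ?_
  simp only [Matrix.adjugate_apply]
  refine contDiff_det fun a b => ?_
  by_cases h : a = j
  · subst h; simpa using contDiff_const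
  · simpa [Matrix.updateRow_ne h] using contDiff_one_add_sq hF a b

lemma invMetric_mul (x : Fin n → ℝ) : invMetric F x * (1 + Hess n F x * Hess n F x) = 1 :=
  Matrix.nonsing_inv_mul _ (zero_lt_one.trans_le (one_le_det hF x)).ne'.isUnit

lemma mul_invMetric (x : Fin n → ℝ) : (1 + Hess n F x * Hess n F x) * invMetric F x = 1 :=
  Matrix.mul_nonsing_inv _ (zero_lt_one.trans_le (one_le_det hF x)).ne'.isUnit

lemma invMetric_transpose (x : Fin n → ℝ) : (invMetric F x).transpose = invMetric F x := by
  rw [invMetric, Matrix.transpose_nonsing_inv, Matrix.transpose_add, Matrix.transpose_mul,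
    Hess_transpose hF, Matrix.transpose_one]

lemma invMetric_comm (x : Fin n → ℝ) (i j : Fin n) : invMetric F x i j = invMetric F x j i := by
  conv_lhs => rw [← invMetric_transpose hF x]
  rfl

lemma Hess_mul_invMetric (x : Fin n → ℝ) :
    Hess n F x * invMetric F x = invMetric F x * Hess n F x := by
  have h1 := invMetric_mul hF x
  have h2 := mul_invMetric hF x
  set G := invMetric F x
  set H := Hess n F x
  have hc : (1 + H * H) * H = H * (1 + H * H) := by noncomm_ring
  calc H * G = G * ((1 + H * H) * H) * G := by
        rw [← Matrix.mul_assoc, h1, Matrix.one_mul]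
    _ = G * H * ((1 + H * H) * G) := by rw [hc]; simp only [Matrix.mul_assoc]
    _ = G * H := by rw [h2, Matrix.mul_one]

lemma contDiff_Hess_mul_invMetric (i j : Fin n) :
    ContDiff ℝ ∞ (fun x => (Hess n F x * invMetric F x) i j) := by
  simp only [Matrix.mul_apply]
  exact ContDiff.sum fun k _ => (contDiff_Hess hF i k).mul (contDiff_invMetric hF k j)

lemma third_swap_left (x : Fin n → ℝ) (i j k : Fin n) :
    mpd i (Hess n F) x j k = mpd j (Hess n F) x i k :=
  pd_comm (contDiff_pd hF k) i j x

lemma third_swap_right (x : Fin n → ℝ) (i j k : Fin n) :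
    mpd i (Hess n F) x j k = mpd i (Hess n F) x k j := by
  have : (fun y => Hess n F y j k) = fun y => Hess n F y k j := funext fun y => Hess_comm hF y j k
  simp only [mpd, this]

lemma pd_volDensity_and_trace (hP : ConstPhase F) (k : Fin n) (x : Fin n → ℝ) :
    pd k (volDensity F) x
      = volDensity F x * (Hess n F x * invMetric F x * mpd k (Hess n F) x).trace ∧
    (invMetric F x * mpd k (Hess n F) x).trace = 0 := by
  obtain ⟨Θ, hΘ⟩ := hP
  have hHd (i j) : DifferentiableAt ℝ (fun y => Hess n F y i j) x :=
    (contDiff_Hess hF i j).differentiable (by simp) x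
  have hvd : DifferentiableAt ℝ (volDensity F) x :=
    (contDiff_volDensity hF).differentiable (by simp) x
  have hZd (i j) : DifferentiableAt ℝ
      (fun y => (1 + Complex.I • (Hess n F y).map Complex.ofReal : Matrix _ _ ℂ) i j) x := by
    simp only [Matrix.add_apply, Matrix.smul_apply, Matrix.map_apply, smul_eq_mul]
    exact ((Complex.ofRealCLM.differentiableAt.comp x (hHd i j)).const_mul _).const_add _
  have h1 := pd_det k hZd
  have hmp : mpd k (fun y => (1 + Complex.I • (Hess n F y).map Complex.ofReal : Matrix _ _ ℂ)) x
      = Complex.I • (mpd k (Hess n F) x).map Complex.ofReal := by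
    ext i j
    simp only [mpd, Matrix.add_apply, Matrix.smul_apply, Matrix.map_apply, smul_eq_mul]
    have hc : DifferentiableAt ℝ (fun y => ((Hess n F y i j : ℝ) : ℂ)) x :=
      Complex.ofRealCLM.differentiableAt.comp x (hHd i j)
    rw [pd_add k (by fun_prop) (hc.const_mul _), pd_mul k (by fun_prop) hc, pd_const, pd_const,
      pd_ofReal k (hHd i j)]
    simp
  have h2 : pd k (fun y => (1 + Complex.I • (Hess n F y).map Complex.ofReal : Matrix _ _ ℂ).det) x
      = Complex.exp (Θ * Complex.I) * ((pd k (volDensity F) x : ℝ) : ℂ) := by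
    have : (fun y => (1 + Complex.I • (Hess n F y).map Complex.ofReal : Matrix _ _ ℂ).det)
      = fun y => Complex.exp (Θ * Complex.I) * (volDensity F y : ℝ) := funext hΘ
    have hc : DifferentiableAt ℝ (fun y => ((volDensity F y : ℝ) : ℂ)) x :=
      Complex.ofRealCLM.differentiableAt.comp x hvd
    rw [this, pd_mul k (differentiableAt_const _) hc, pd_const, pd_ofReal k hvd]
    simp
  set H := Hess n F x with hH
  set G := invMetric F x with hG
  set T := mpd k (Hess n F) x with hT
  have hGH : G * (1 + H * H) = 1 := invMetric_mul hF x
  have hHG : H * G = G * H := Hess_mul_invMetric hF x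
  set Z : Matrix (Fin n) (Fin n) ℂ := 1 + Complex.I • H.map Complex.ofReal with hZ
  set φ := (Complex.ofRealHom.mapMatrix : Matrix (Fin n) (Fin n) ℝ →+* Matrix (Fin n) (Fin n) ℂ)
    with hφ
  have hinv : Z * (φ G - Complex.I • φ (H * G)) = 1 := by
    have hZ' : Z = 1 + Complex.I • φ H := rfl
    rw [hZ', map_mul]
    have c1 : φ G * φ H = φ H * φ G := by rw [← map_mul, ← map_mul, hHG]
    have c2 : φ G + φ H * φ H * φ G = 1 := by
      rw [← map_mul, ← map_mul, ← map_add, ← map_one φ, ← mul_invMetric hF x]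
      congr 1
      rw [add_mul, one_mul]
    simp only [mul_sub, add_mul, one_mul, Matrix.smul_mul, Matrix.mul_smul, smul_smul,
      Complex.I_mul_I]
    rw [← c2, ← mul_assoc]
    simp only [neg_smul, one_smul]
    abel
  have hadj : Z.adjugate = Z.det • (φ G - Complex.I • φ (H * G)) := by
    calc Z.adjugate = Z.adjugate * (Z * (φ G - Complex.I • φ (H * G))) := by
          rw [hinv, mul_one]
      _ = _ := by rw [← mul_assoc, Matrix.adjugate_mul, Matrix.smul_mul, one_mul]
  have htr (M : Matrix (Fin n) (Fin n) ℝ) : (φ M).trace = ((M.trace : ℝ) : ℂ) := by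
    simp [hφ, Matrix.trace]
  rw [h2, hmp, hadj, hΘ x] at h1
  have hTφ : T.map Complex.ofReal = φ T := rfl
  rw [hTφ, Matrix.smul_mul, Matrix.trace_smul, Matrix.mul_smul, Matrix.trace_smul, sub_mul,
    Matrix.trace_sub, Matrix.smul_mul, Matrix.trace_smul, ← map_mul, ← map_mul, htr, htr,
    smul_eq_mul, smul_eq_mul, smul_eq_mul, mul_assoc] at h1
  have h3 := mul_left_cancel₀ (Complex.exp_ne_zero _) h1
  have hre := congrArg Complex.re h3
  have him := congrArg Complex.im h3
  simp at hre him
  exact ⟨hre, him.resolve_left (volDensity_pos hF x).ne'⟩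

end sl

section sl
variable {n : ℕ} {F : (Fin n → ℝ) → ℝ} (hF : ContDiff ℝ ∞ F)
include hF

lemma differentiableAt_Hess (x : Fin n → ℝ) (i j : Fin n) :
    DifferentiableAt ℝ (fun y => Hess n F y i j) x :=
  (contDiff_Hess hF i j).differentiable (by simp) x

lemma differentiableAt_invMetric (x : Fin n → ℝ) (i j : Fin n) :
    DifferentiableAt ℝ (fun y => invMetric F y i j) x :=
  (contDiff_invMetric hF i j).differentiable (by simp) x

lemma differentiableAt_volDensity (x : Fin n → ℝ) : DifferentiableAt ℝ (volDensity F) x :=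
  (contDiff_volDensity hF).differentiable (by simp) x

lemma Hess_sq_mul_invMetric (x : Fin n → ℝ) :
    Hess n F x * (Hess n F x * invMetric F x) = 1 - invMetric F x := by
  rw [eq_sub_iff_add_eq, ← mul_invMetric hF x, add_mul, one_mul, add_comm, mul_assoc]

lemma mpd_invMetric (k : Fin n) (x : Fin n → ℝ) :
    mpd k (invMetric F) x
      = -(invMetric F x * mpd k (Hess n F) x * (Hess n F x * invMetric F x)
        + Hess n F x * invMetric F x * mpd k (Hess n F) x * invMetric F x) := by
  have h1 : mpd k (fun y => (1 + Hess n F y * Hess n F y) * invMetric F y) x = 0 := by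
    simp only [mul_invMetric hF]
    ext i j
    simp [mpd]
  have h2 : mpd k (fun y => 1 + Hess n F y * Hess n F y) x
      = mpd k (Hess n F) x * Hess n F x + Hess n F x * mpd k (Hess n F) x := by
    rw [← mpd_mul k (differentiableAt_Hess hF x) (differentiableAt_Hess hF x)]
    ext i j
    simp only [mpd, Matrix.add_apply]
    rw [pd_add k (differentiableAt_const _), pd_const, zero_add]
    simp only [Matrix.mul_apply]
    exact DifferentiableAt.fun_sum fun a _ =>
      (differentiableAt_Hess hF x i a).fun_mul (differentiableAt_Hess hF x a j)
  rw [mpd_mul k (fun i j => (contDiff_one_add_sq hF i j).differentiable (by simp) x)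
    (differentiableAt_invMetric hF x), h2] at h1
  have h3 := congrArg (fun M => invMetric F x * M) h1
  simp only [mul_add, ← mul_assoc, mul_zero] at h3
  have h4 : invMetric F x * (1 + Hess n F x * Hess n F x) = 1 := invMetric_mul hF x
  rw [mul_add, mul_one] at h4
  have h5 : invMetric F x * mpd k (invMetric F) x + invMetric F x * Hess n F x * Hess n F x
      * mpd k (invMetric F) x = mpd k (invMetric F) x := by
    rw [← add_mul, mul_assoc (invMetric F x), h4, one_mul]
  rw [Hess_mul_invMetric hF x]
  have h6 := Hess_mul_invMetric hF x
  simp only [mul_one] at h3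
  rw [eq_neg_iff_add_eq_zero, ← h3]
  nth_rw 1 [← h5]
  have h7 : invMetric F x * mpd k (Hess n F) x * (invMetric F x * Hess n F x)
      = invMetric F x * mpd k (Hess n F) x * Hess n F x * invMetric F x := by
    rw [← h6, ← mul_assoc]
  rw [h7]
  noncomm_ring

lemma mpd_Hess_mul_invMetric (k : Fin n) (x : Fin n → ℝ) :
    mpd k (fun y => Hess n F y * invMetric F y) x
      = invMetric F x * mpd k (Hess n F) x * invMetric F x
        - Hess n F x * invMetric F x * mpd k (Hess n F) x * (Hess n F x * invMetric F x) := by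
  rw [mpd_mul k (differentiableAt_Hess hF x) (differentiableAt_invMetric hF x),
    mpd_invMetric hF, mul_neg, mul_add]
  have h := Hess_sq_mul_invMetric hF x
  have : Hess n F x * (Hess n F x * invMetric F x * mpd k (Hess n F) x * invMetric F x)
      = (1 - invMetric F x) * mpd k (Hess n F) x * invMetric F x := by
    rw [← h]; simp only [mul_assoc]
  rw [this]
  noncomm_ring

lemma sum_pd_volDensity_mul_invMetric (hP : ConstPhase F) (j : Fin n) (x : Fin n → ℝ) :
    ∑ i, pd i (fun y => volDensity F y * invMetric F y i j) x = 0 := by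
  have hT := third_swap_left hF x
  have hT' := third_swap_right hF x
  have h0 (i : Fin n) : pd i (fun y => volDensity F y * invMetric F y i j) x
      = volDensity F x * ((Hess n F x * invMetric F x * mpd i (Hess n F) x).trace
          * invMetric F x i j - (Hess n F x * invMetric F x * mpd i (Hess n F) x * invMetric F x) i j)
        - volDensity F x *
          (invMetric F x * mpd i (Hess n F) x * (Hess n F x * invMetric F x)) i j := by
    rw [pd_mul i (differentiableAt_volDensity hF x) (differentiableAt_invMetric hF x i j),
      (pd_volDensity_and_trace hF hP i x).1]
    have : pd i (fun y => invMetric F y i j) x = mpd i (invMetric F) x i j := rfl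
    rw [this, mpd_invMetric hF]
    simp only [Matrix.neg_apply, Matrix.add_apply]
    ring
  simp only [h0]
  rw [Finset.sum_sub_distrib, ← Finset.mul_sum, ← Finset.mul_sum, Finset.sum_sub_distrib]
  have e0 (b : Fin n) := (pd_volDensity_and_trace hF hP b x).2
  set S := Hess n F x * invMetric F x
  set G := invMetric F x
  have e1 : ∑ i, (S * mpd i (Hess n F) x).trace * G i j
      = ∑ i, (S * mpd i (Hess n F) x * G) i j := by
    simp only [Matrix.trace, Matrix.diag, Matrix.mul_apply, Finset.sum_mul]
    rw [Finset.sum_comm]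
    refine Finset.sum_congr rfl fun a _ => Finset.sum_congr rfl fun i _ =>
      Finset.sum_congr rfl fun b _ => ?_
    rw [hT' i b a, hT i a b, hT' a i b]
  have e2 : ∑ i, (G * mpd i (Hess n F) x * S) i j = 0 := by
    have : ∑ i, (G * mpd i (Hess n F) x * S) i j
        = ∑ b, (G * mpd b (Hess n F) x).trace * S b j := by
      simp only [Matrix.trace, Matrix.diag, Matrix.mul_apply, Finset.sum_mul]
      rw [Finset.sum_comm]
      refine Finset.sum_congr rfl fun a _ => Finset.sum_congr rfl fun i _ =>
        Finset.sum_congr rfl fun b _ => ?_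
      rw [hT' i b a, hT i a b, hT' a i b]
    rw [this]
    simp [e0]
  rw [e1, e2]
  simp

lemma le_lap_log_volDensity (hP : ConstPhase F) {K : ℝ} (x : Fin n → ℝ)
    (hprod : ∀ i j, -1 ≤ (Hess_isHermitian hF x).eigenvalues i *
      (Hess_isHermitian hF x).eigenvalues j)
    (hbdd : ∀ i, |(Hess_isHermitian hF x).eigenvalues i| ≤ K) :
    (1 / 3) * (1 / (1 + K ^ 2)) ^ 3 * ∑ k, ∑ i, ∑ j, mpd k (Hess n F) x i j ^ 2
      ≤ lap F (fun y => Real.log (volDensity F y)) x := by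
  have hvd := differentiableAt_volDensity hF
  have hp := volDensity_pos hF
  have hTs (k i j : Fin n) : ContDiff ℝ ∞ fun y => mpd k (Hess n F) y i j :=
    contDiff_pd (contDiff_Hess hF i j) k
  have hTd (k i j : Fin n) : DifferentiableAt ℝ (fun y => mpd k (Hess n F) y i j) x :=
    (hTs k i j).differentiable (by simp) x
  have hSd (i j : Fin n) :
      DifferentiableAt ℝ (fun y => (Hess n F y * invMetric F y) i j) x :=
    (contDiff_Hess_mul_invMetric hF i j).differentiable (by simp) x
  have h1 (k : Fin n) : pd k (fun y => Real.log (volDensity F y))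
      = fun y => (Hess n F y * invMetric F y * mpd k (Hess n F) y).trace := by
    funext y
    rw [pd_comp k (Real.hasDerivAt_log (hp y).ne') (hvd y), (pd_volDensity_and_trace hF hP k y).1,
      smul_eq_mul]
    field_simp [(hp y).ne']
  set T := fun k => mpd k (Hess n F) x with hTdef
  set Q := fun l k => mpd l (mpd k (Hess n F)) x with hQ
  have hmm {A B : (Fin n → ℝ) → Matrix (Fin n) (Fin n) ℝ}
      (hA : ∀ i j, DifferentiableAt ℝ (fun y => A y i j) x)
      (hB : ∀ i j, DifferentiableAt ℝ (fun y => B y i j) x) (k : Fin n) :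
      pd k (fun y => (A y * B y).trace) x = (mpd k A x * B x).trace + (A x * mpd k B x).trace := by
    rw [pd_trace, mpd_mul k hA hB, Matrix.trace_add]
    intro i j
    simp only [Matrix.mul_apply]
    exact DifferentiableAt.fun_sum fun a _ => (hA i a).fun_mul (hB a j)
  have h2 (l k : Fin n) : pd l (pd k (fun y => Real.log (volDensity F y))) x
      = (mpd l (fun y => Hess n F y * invMetric F y) x * T k).trace
        + (Hess n F x * invMetric F x * Q l k).trace := by
    rw [h1 k]
    exact hmm hSd (hTd k) l
  have h3 (b a : Fin n) : (mpd b (invMetric F) x * T a).trace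
      + (invMetric F x * Q b a).trace = 0 := by
    rw [← hmm (differentiableAt_invMetric hF x) (hTd a) b]
    have : (fun y => (invMetric F y * mpd a (Hess n F) y).trace) = fun _ => 0 :=
      funext fun y => (pd_volDensity_and_trace hF hP a y).2
    rw [this, pd_const]
  have hT := third_swap_left hF x
  have hT' := third_swap_right hF x
  have hfun (k i j : Fin n) : (fun y => mpd k (Hess n F) y i j) = pd k (pd i (pd j F)) := rfl
  have hQ1 (l k i j : Fin n) : Q l k i j = Q k l i j := pd_comm (contDiff_Hess hF i j) l k x
  have hQ2 (l k i j : Fin n) : Q l k i j = Q l i k j := by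
    have : (fun y => mpd k (Hess n F) y i j) = fun y => mpd i (Hess n F) y k j :=
      funext fun y => third_swap_left hF y k i j
    simp only [hQ, mpd] at this ⊢
    rw [this]
  have hQ3 (l k i j : Fin n) : Q l k i j = Q l k j i := by
    have : (fun y => mpd k (Hess n F) y i j) = fun y => mpd k (Hess n F) y j i :=
      funext fun y => third_swap_right hF y k i j
    simp only [hQ, mpd] at this ⊢
    rw [this]
  have hle := le_cubic (Hess_isHermitian hF x) hprod hbdd hT hT' (G := invMetric F x)
    (S := Hess n F x * invMetric F x) rfl rfl
  have hGs := invMetric_comm hF x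
  have hdS (l : Fin n) := mpd_Hess_mul_invMetric hF l x
  have hdG (l : Fin n) := mpd_invMetric hF l x
  have hlap : lap F (fun y => Real.log (volDensity F y)) x = volDensity F x *
      (∑ l, ∑ k, invMetric F x l k *
        (mpd l (fun y => Hess n F y * invMetric F y) x * T k).trace
        + ∑ l, ∑ k, invMetric F x l k * (Hess n F x * invMetric F x * Q l k).trace) := by
    simp only [lap, h2, ← Finset.sum_add_distrib, Finset.mul_sum]
    refine Finset.sum_congr rfl fun l _ => Finset.sum_congr rfl fun k _ => ?_
    ring
  set S := Hess n F x * invMetric F x with hS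
  set G := invMetric F x
  have e1 : ∑ l, ∑ k, G l k *
        (mpd l (fun y => Hess n F y * invMetric F y) x * T k).trace
      = cubic G G G T - cubic G S S T := by
    rw [Finset.sum_comm]
    simp only [cubic, ← Finset.sum_sub_distrib]
    refine Finset.sum_congr rfl fun k _ => Finset.sum_congr rfl fun l _ => ?_
    rw [hdS, sub_mul, Matrix.trace_sub, hGs l k, ← mul_sub]
  have e2 : ∑ l, ∑ k, G l k * (S * Q l k).trace = ∑ a, ∑ b, S a b * (G * Q b a).trace := by
    simp only [Matrix.trace, Matrix.diag, Matrix.mul_apply, Finset.mul_sum]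
    calc ∑ l, ∑ k, ∑ a, ∑ b, G l k * (S a b * Q l k b a)
        = ∑ l, ∑ a, ∑ k, ∑ b, G l k * (S a b * Q l k b a) :=
          Finset.sum_congr rfl fun l _ => Finset.sum_comm
      _ = ∑ a, ∑ l, ∑ k, ∑ b, G l k * (S a b * Q l k b a) := Finset.sum_comm
      _ = ∑ a, ∑ l, ∑ b, ∑ k, G l k * (S a b * Q l k b a) :=
          Finset.sum_congr rfl fun a _ => Finset.sum_congr rfl fun l _ => Finset.sum_comm
      _ = ∑ a, ∑ b, ∑ l, ∑ k, G l k * (S a b * Q l k b a) :=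
          Finset.sum_congr rfl fun a _ => Finset.sum_comm
      _ = ∑ a, ∑ b, ∑ l, ∑ k, S a b * (G l k * Q b a k l) := by
          refine Finset.sum_congr rfl fun a _ => Finset.sum_congr rfl fun b _ =>
            Finset.sum_congr rfl fun l _ => Finset.sum_congr rfl fun k _ => ?_
          have : Q l k b a = Q b a k l := by
            rw [hQ2 l k b a, hQ1 l b k a, hQ3 b l k a, hQ2 b l a k, hQ3]
          rw [this]
          ring
  have e3 : ∑ a, ∑ b, S a b * (G * Q b a).trace = cubic S S G T + cubic S G S T := by
    simp only [cubic, ← Finset.sum_add_distrib]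
    refine Finset.sum_congr rfl fun a _ => Finset.sum_congr rfl fun b _ => ?_
    have := h3 b a
    rw [hdG, neg_mul, add_mul, Matrix.trace_neg, Matrix.trace_add] at this
    rw [← mul_add]
    congr 1
    linarith
  rw [e1, e2, e3] at hlap
  rw [hlap]
  have hnn : 0 ≤ (1 / 3) * (1 / (1 + K ^ 2)) ^ 3 * ∑ k, ∑ i, ∑ j, T k i j ^ 2 := by positivity
  nlinarith [one_le_volDensity hF x]

end sl

section sl
variable {n : ℕ}

/-- Squared distance between the points of the graph of `∇F` lying over `p` and `x`. -/
noncomputable def distSq (F : (Fin n → ℝ) → ℝ) (p x : Fin n → ℝ) : ℝ :=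
  ∑ k, ((x k - p k) ^ 2 + (pd k F x - pd k F p) ^ 2)

/-- Deviation of `∇F` from being homogeneous of degree one about `p`. -/
noncomputable def homDefect (F : (Fin n → ℝ) → ℝ) (p x : Fin n → ℝ) (k : Fin n) : ℝ :=
  pd k F x - pd k F p - (Hess n F x).mulVec (x - p) k

/-- Squared length of the normal component of the position vector of the graph. -/
noncomputable def normalSq (F : (Fin n → ℝ) → ℝ) (p x : Fin n → ℝ) : ℝ :=
  homDefect F p x ⬝ᵥ (invMetric F x).mulVec (homDefect F p x)

variable {F : (Fin n → ℝ) → ℝ} (hF : ContDiff ℝ ∞ F)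

lemma distSq_nonneg (p x : Fin n → ℝ) : 0 ≤ distSq F p x :=
  Finset.sum_nonneg fun _ _ => by positivity

lemma norm_sq_le_distSq (p x : Fin n → ℝ) : ‖x - p‖ ^ 2 ≤ distSq F p x := by
  have h : ‖x - p‖ ≤ √(distSq F p x) := by
    refine (pi_norm_le_iff_of_nonneg (Real.sqrt_nonneg _)).2 fun k => ?_
    refine Real.abs_le_sqrt ?_
    have := Finset.single_le_sum (f := fun k => (x k - p k) ^ 2 + (pd k F x - pd k F p) ^ 2)
      (fun k _ => by positivity) (Finset.mem_univ k)
    simp only [Pi.sub_apply]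
    unfold distSq
    nlinarith [sq_nonneg (pd k F x - pd k F p)]
  calc ‖x - p‖ ^ 2 ≤ √(distSq F p x) ^ 2 := by gcongr
    _ = _ := Real.sq_sqrt (distSq_nonneg _ _)

include hF

lemma contDiff_distSq (p : Fin n → ℝ) : ContDiff ℝ ∞ (distSq F p) := by
  unfold distSq
  refine ContDiff.sum fun k _ => ContDiff.add ?_ ?_
  · fun_prop
  · exact ((contDiff_pd hF k).sub contDiff_const).pow 2

omit hF in
lemma lap_sum {ι : Type*} (s : Finset ι) {f : ι → (Fin n → ℝ) → ℝ}
    (hf : ∀ a ∈ s, ContDiff ℝ ∞ (f a)) (x : Fin n → ℝ) :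
    lap F (fun y => ∑ a ∈ s, f a y) x = ∑ a ∈ s, lap F (f a) x := by
  have h (i j : Fin n) : pd i (pd j (fun y => ∑ a ∈ s, f a y)) x
      = ∑ a ∈ s, pd i (pd j (f a)) x := by
    have : pd j (fun y => ∑ a ∈ s, f a y) = fun y => ∑ a ∈ s, pd j (f a) y :=
      funext fun y => pd_sum _ _ fun a ha => (hf a ha).differentiable (by simp) y
    rw [this]
    exact pd_sum _ _ fun a ha => (contDiff_pd (hf a ha) j).differentiable (by simp) x
  simp only [lap, h, Finset.mul_sum]
  exact (Finset.sum_congr rfl fun i _ => Finset.sum_comm).trans Finset.sum_comm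

omit hF in
lemma lap_add {f g : (Fin n → ℝ) → ℝ} (hf : ContDiff ℝ ∞ f) (hg : ContDiff ℝ ∞ g)
    (x : Fin n → ℝ) : lap F (fun y => f y + g y) x = lap F f x + lap F g x := by
  have := lap_sum (F := F) (Finset.univ : Finset Bool) (f := fun b => cond b f g)
    (by rintro (_ | _) _ <;> assumption) x
  simpa using this

omit hF in
lemma lap_comp {f : (Fin n → ℝ) → ℝ} (hf : ContDiff ℝ ∞ f) {φ φ₁ φ₂ : ℝ → ℝ}
    (h₁ : ∀ t, HasDerivAt φ (φ₁ t) t) (h₂ : ∀ t, HasDerivAt φ₁ (φ₂ t) t) (x : Fin n → ℝ) :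
    lap F (fun y => φ (f y)) x = φ₂ (f x) * (∑ i, ∑ j, volDensity F x * invMetric F x i j *
      (pd i f x * pd j f x)) + φ₁ (f x) * lap F f x := by
  have hfd : Differentiable ℝ f := hf.differentiable (by simp)
  have h (i j : Fin n) : pd i (pd j (fun y => φ (f y))) x
      = φ₂ (f x) * (pd i f x * pd j f x) + φ₁ (f x) * pd i (pd j f) x := by
    have e : pd j (fun y => φ (f y)) = fun y => pd j f y * φ₁ (f y) :=
      funext fun y => pd_comp j (h₁ _) (hfd y)
    have hc : DifferentiableAt ℝ (fun y => φ₁ (f y)) x :=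
      (h₂ (f x)).differentiableAt.comp x (hfd x)
    rw [e, pd_mul i ((contDiff_pd hf j).differentiable (by simp) x) hc, pd_comp i (h₂ _) (hfd x), smul_eq_mul]
    ring
  simp only [lap, h, Finset.mul_sum, ← Finset.sum_add_distrib]
  refine Finset.sum_congr rfl fun i _ => Finset.sum_congr rfl fun j _ => ?_
  ring

omit hF in
lemma hasDerivAt_sub_const_sq (c t : ℝ) : HasDerivAt (fun t => (t - c) ^ 2) (2 * (t - c)) t := by
  have := ((hasDerivAt_id t).sub_const c).fun_pow 2
  simpa using this

omit hF in
lemma lap_sub_const_sq {f : (Fin n → ℝ) → ℝ} (hf : ContDiff ℝ ∞ f) (c : ℝ) (x : Fin n → ℝ)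
    (h0 : lap F f x = 0) : lap F (fun y => (f y - c) ^ 2) x =
      2 * ∑ i, ∑ j, volDensity F x * invMetric F x i j * (pd i f x * pd j f x) := by
  rw [lap_comp (φ := fun t => (t - c) ^ 2) (φ₁ := fun t => 2 * (t - c)) (φ₂ := fun _ => 2) hf
    (hasDerivAt_sub_const_sq c)
    (fun t => by simpa using ((hasDerivAt_id t).sub_const c).const_mul 2), h0]
  ring

lemma lap_distSq (hP : ConstPhase F) (p x : Fin n → ℝ) :
    lap F (distSq F p) x = 2 * n * volDensity F x := by
  have hc (k : Fin n) : ContDiff ℝ ∞ fun y : Fin n → ℝ => y k := by fun_prop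
  have h1 (k : Fin n) : lap F (fun y => (y k - p k) ^ 2) x
      = 2 * (volDensity F x * invMetric F x k k) := by
    rw [lap_sub_const_sq (hc k)]
    · simp [pd_apply, Matrix.one_apply]
    · have (j : Fin n) : pd j (fun y : Fin n → ℝ => y k)
          = fun _ => (1 : Matrix (Fin n) (Fin n) ℝ) j k := funext fun y => pd_apply j k y
      simp [lap, this]
  have h2 (k : Fin n) : lap F (fun y => (pd k F y - pd k F p) ^ 2) x
      = 2 * (volDensity F x * (Hess n F x * (Hess n F x * invMetric F x)) k k) := by
    rw [lap_sub_const_sq (contDiff_pd hF k)]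
    · congr 1
      have hh (i : Fin n) : pd i (pd k F) x = Hess n F x i k := rfl
      rw [Hess_mul_invMetric hF x]
      simp only [Matrix.mul_apply, Finset.mul_sum, hh]
      refine Finset.sum_congr rfl fun i _ => Finset.sum_congr rfl fun j _ => ?_
      rw [Hess_comm hF x k i]
      ring
    · have h3 := (pd_volDensity_and_trace hF hP k x).2
      have hh (i j : Fin n) : pd i (pd j (pd k F)) x = mpd k (Hess n F) x j i := by
        have := third_swap_left hF x i j k
        have h' := third_swap_right hF x j i k
        have h'' := third_swap_left hF x j k i
        calc _ = mpd i (Hess n F) x j k := rfl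
          _ = _ := by rw [this, h', h'']
      simp only [Matrix.trace, Matrix.diag, Matrix.mul_apply] at h3
      simp only [lap, hh, mul_assoc, ← Finset.mul_sum, h3, mul_zero]
  have h3 : lap F (distSq F p) x = ∑ k, (lap F (fun y => (y k - p k) ^ 2) x
      + lap F (fun y => (pd k F y - pd k F p) ^ 2) x) := by
    unfold distSq
    rw [lap_sum]
    · refine Finset.sum_congr rfl fun k _ => lap_add ?_ ?_ x
      · fun_prop
      · exact ((contDiff_pd hF k).sub contDiff_const).pow 2
    · intro k _
      refine ContDiff.add (by fun_prop) (((contDiff_pd hF k).sub contDiff_const).pow 2)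
  rw [h3]
  simp only [h1, h2, Hess_sq_mul_invMetric hF]
  simp only [Matrix.sub_apply, Matrix.one_apply_eq]
  rw [← Finset.sum_congr rfl (fun k _ => show 2 * volDensity F x = _ by ring)]
  simp; ring

lemma pd_distSq (p x : Fin n → ℝ) (i : Fin n) :
    pd i (distSq F p) x
      = 2 * ((x - p) + (Hess n F x).mulVec (fun k => pd k F x - pd k F p)) i := by
  have hpd (k : Fin n) : DifferentiableAt ℝ (pd k F) x :=
    (contDiff_pd hF k).differentiable (by simp) x
  have hsq {f : (Fin n → ℝ) → ℝ} (hf : DifferentiableAt ℝ f x) (c : ℝ) :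
      pd i (fun y => (f y - c) ^ 2) x = 2 * (pd i f x * (f x - c)) := by
    rw [pd_comp (φ := fun t => (t - c) ^ 2) (φ' := 2 * (f x - c)) i
      (hasDerivAt_sub_const_sq c _) hf, smul_eq_mul]
    ring
  unfold distSq
  rw [pd_sum _ _ fun k _ => ?_]
  · have (k : Fin n) : pd i (fun y => (y k - p k) ^ 2 + (pd k F y - pd k F p) ^ 2) x
        = 2 * ((1 : Matrix (Fin n) (Fin n) ℝ) i k * (x k - p k))
          + 2 * (Hess n F x i k * (pd k F x - pd k F p)) := by
      have hk : DifferentiableAt ℝ (fun y => (pd k F y - pd k F p) ^ 2) x :=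
        ((hpd k).sub_const _).pow 2
      rw [pd_add i (by fun_prop) hk, hsq (by fun_prop) (p k),
        hsq (hpd k), pd_apply]
      rfl
    simp only [this, Finset.sum_add_distrib, ← Finset.mul_sum]
    simp [Matrix.mulVec, dotProduct, Matrix.one_apply, mul_add]
  · exact DifferentiableAt.add (by fun_prop) (((hpd k).sub_const _).pow 2)

lemma sum_pd_distSq_sq (p x : Fin n → ℝ) :
    ∑ i, ∑ j, volDensity F x * invMetric F x i j * (pd i (distSq F p) x * pd j (distSq F p) x)
      = 4 * volDensity F x * (distSq F p x - normalSq F p x) := by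
  simp only [pd_distSq hF]
  set u : Fin n → ℝ := fun k => pd k F x - pd k F p with hu
  set a := x - p with ha
  set H := Hess n F x with hH
  set G := invMetric F x with hG
  have hHT : H.transpose = H := Hess_transpose hF x
  have hHG : H * G = G * H := Hess_mul_invMetric hF x
  have hHHG : H * (H * G) = 1 - G := Hess_sq_mul_invMetric hF x
  have hN : normalSq F p x = (u - H.mulVec a) ⬝ᵥ G.mulVec (u - H.mulVec a) := rfl
  have hr : distSq F p x = a ⬝ᵥ a + u ⬝ᵥ u := by
    simp [distSq, dotProduct, hu, ha, ← Finset.sum_add_distrib, sq]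
  have hm (b c : Fin n → ℝ) : (H.mulVec b) ⬝ᵥ c = b ⬝ᵥ H.mulVec c := by
    rw [Matrix.dotProduct_mulVec, ← Matrix.mulVec_transpose, hHT]
  have hg (b c : Fin n → ℝ) : b ⬝ᵥ G.mulVec c = c ⬝ᵥ G.mulVec b := by
    rw [Matrix.dotProduct_mulVec, ← Matrix.mulVec_transpose, invMetric_transpose hF,
      dotProduct_comm]
  have lhs : ∑ i, ∑ j, volDensity F x * G i j * (2 * (a + H.mulVec u) i * (2 * (a + H.mulVec u) j))
      = 4 * volDensity F x * ((a + H.mulVec u) ⬝ᵥ G.mulVec (a + H.mulVec u)) := by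
    simp only [dotProduct, Matrix.mulVec, Finset.mul_sum]
    refine Finset.sum_congr rfl fun i _ => Finset.sum_congr rfl fun j _ => ?_
    ring
  rw [lhs, hN, hr]
  congr 1
  have key (b : Fin n → ℝ) : b ⬝ᵥ H.mulVec (G.mulVec (H.mulVec b)) = b ⬝ᵥ b - b ⬝ᵥ G.mulVec b := by
    rw [Matrix.mulVec_mulVec, Matrix.mulVec_mulVec, mul_assoc, ← hHG, hHHG, Matrix.sub_mulVec,
      Matrix.one_mulVec, dotProduct_sub]
  have cross : u ⬝ᵥ H.mulVec (G.mulVec a) = u ⬝ᵥ G.mulVec (H.mulVec a) := by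
    rw [Matrix.mulVec_mulVec, Matrix.mulVec_mulVec, hHG]
  have c2 : a ⬝ᵥ G.mulVec (H.mulVec u) = u ⬝ᵥ H.mulVec (G.mulVec a) := by
    rw [hg, hm]
  have c3 : a ⬝ᵥ H.mulVec (G.mulVec u) = u ⬝ᵥ G.mulVec (H.mulVec a) := by
    rw [← hm, hg]
  simp only [Matrix.mulVec_add, Matrix.mulVec_sub, add_dotProduct, sub_dotProduct, dotProduct_add,
    dotProduct_sub, hm, key, cross, c2, c3]
  ring

lemma posDef_one_add_sq (x : Fin n → ℝ) : (1 + Hess n F x * Hess n F x).PosDef := by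
  refine Matrix.PosDef.one.add_posSemidef ?_
  have := Matrix.posSemidef_conjTranspose_mul_self (Hess n F x)
  rwa [(Hess_isHermitian hF x).eq] at this

lemma posDef_invMetric (x : Fin n → ℝ) : (invMetric F x).PosDef := (posDef_one_add_sq hF x).inv

lemma normalSq_nonneg (p x : Fin n → ℝ) : 0 ≤ normalSq F p x := by
  have := (posDef_invMetric hF x).posSemidef.dotProduct_mulVec_nonneg (homDefect F p x)
  rwa [star_trivial] at this

lemma homDefect_eq_zero {p x : Fin n → ℝ} (h : normalSq F p x = 0) : homDefect F p x = 0 := by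
  by_contra h0
  have := (posDef_invMetric hF x).dotProduct_mulVec_pos h0
  simp only [star_trivial] at this
  exact this.ne' h

lemma continuous_normalSq (p : Fin n → ℝ) : Continuous (normalSq F p) := by
  have h1 (k : Fin n) : Continuous fun x => homDefect F p x k := by
    simp only [homDefect, Matrix.mulVec, dotProduct]
    refine ((contDiff_pd hF k).continuous.sub continuous_const).sub
      (continuous_finsetSum _ fun i _ => (contDiff_Hess hF k i).continuous.mul (by fun_prop))
  unfold normalSq
  simp only [Matrix.mulVec, dotProduct]
  exact continuous_finsetSum _ fun i _ => (h1 i).mul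
    (continuous_finsetSum _ fun j _ => (contDiff_invMetric hF i j).continuous.mul (h1 j))

end sl

section cutoff

/-- The cutoff function `max(0, 1 - s) ^ k`. -/
noncomputable def cutoff (k : ℕ) (s : ℝ) : ℝ := max 0 (1 - s) ^ k

lemma cutoff_nonneg (k : ℕ) (s : ℝ) : 0 ≤ cutoff k s := pow_nonneg (le_max_left _ _) _

lemma cutoff_le_one (k : ℕ) {s : ℝ} (hs : 0 ≤ s) : cutoff k s ≤ 1 :=
  pow_le_one₀ (le_max_left _ _) (max_le zero_le_one (by linarith))

lemma cutoff_eq_zero {k : ℕ} (hk : k ≠ 0) {s : ℝ} (hs : 1 ≤ s) : cutoff k s = 0 := by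
  rw [cutoff, max_eq_left (by linarith), zero_pow hk]

lemma cutoff_pos (k : ℕ) {s : ℝ} (hs : s < 1) : 0 < cutoff k s := by
  rw [cutoff, max_eq_right (by linarith)]
  exact pow_pos (by linarith) _

lemma continuous_cutoff (k : ℕ) : Continuous (cutoff k) := by unfold cutoff; fun_prop

lemma hasDerivAt_cutoff (k : ℕ) (s : ℝ) :
    HasDerivAt (cutoff (k + 2)) (-(k + 2) * cutoff (k + 1) s) s := by
  rcases lt_trichotomy s 1 with h | rfl | h
  · have h1 : HasDerivAt (fun s : ℝ => (1 - s) ^ (k + 2)) (-(k + 2) * cutoff (k + 1) s) s := by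
      have := ((hasDerivAt_id s).const_sub 1).fun_pow (k + 2)
      rw [cutoff, max_eq_right (by linarith)]
      have e : k + 2 - 1 = k + 1 := rfl
      rw [e] at this
      refine this.congr_deriv ?_
      push_cast
      simp only [id]
      ring
    refine h1.congr_of_eventuallyEq ?_
    filter_upwards [gt_mem_nhds h] with t ht
    rw [cutoff, max_eq_right (by linarith)]
  · have h0 : cutoff (k + 1) 1 = 0 := cutoff_eq_zero (by simp) le_rfl
    rw [h0, mul_zero]
    have hO : (fun t => cutoff (k + 2) t - cutoff (k + 2) 1) =o[nhds 1] fun t => t - (1 : ℝ) := by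
      rw [cutoff_eq_zero (by simp) le_rfl]
      refine Asymptotics.IsLittleO.of_isBigOWith fun c hc => ?_
      rw [Asymptotics.isBigOWith_iff]
      filter_upwards [Metric.ball_mem_nhds (1 : ℝ) (lt_min hc one_pos)] with t ht
      rw [Metric.mem_ball, Real.dist_eq, lt_min_iff] at ht
      have hm : max 0 (1 - t) ≤ |t - 1| := by
        rw [abs_sub_comm]; exact max_le (abs_nonneg _) (le_abs_self _)
      rw [sub_zero, Real.norm_eq_abs, Real.norm_eq_abs, abs_of_nonneg (cutoff_nonneg _ _), cutoff,
        pow_succ]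
      have hm0 : 0 ≤ max 0 (1 - t) := le_max_left _ _
      have : max 0 (1 - t) ^ (k + 1) ≤ c := by
        calc max 0 (1 - t) ^ (k + 1) ≤ max 0 (1 - t) :=
              pow_le_of_le_one hm0 (hm.trans ht.2.le) (by simp)
          _ ≤ c := hm.trans ht.1.le
      gcongr
    rw [hasDerivAt_iff_isLittleO]
    simpa using hO
  · rw [cutoff_eq_zero (by simp) h.le, mul_zero]
    refine (hasDerivAt_const s (0 : ℝ)).congr_of_eventuallyEq ?_
    filter_upwards [lt_mem_nhds h] with t ht
    exact cutoff_eq_zero (by simp) ht.le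

lemma contDiff_cutoff (k : ℕ) : ContDiff ℝ k (cutoff (k + 1)) := by
  induction k with
  | zero => exact contDiff_zero.2 (continuous_cutoff _)
  | succ k ih =>
    rw [Nat.cast_succ, contDiff_succ_iff_deriv]
    refine ⟨fun s => (hasDerivAt_cutoff k s).differentiableAt, by simp, ?_⟩
    have : deriv (cutoff (k + 1 + 1)) = fun s => -(k + 2 : ℝ) * cutoff (k + 1) s :=
      funext fun s => (hasDerivAt_cutoff k s).deriv
    rw [this]
    exact contDiff_const.mul ih

end cutoff

section parts
variable {n : ℕ}

lemma two_le_infty : (2 : WithTop ℕ∞) ≤ ∞ := by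
  simpa using WithTop.coe_le_coe.2 (le_top : (2 : ℕ∞) ≤ ⊤)

lemma integral_pd_eq_zero {f : (Fin n → ℝ) → ℝ} (hf : ContDiff ℝ 1 f) (hc : HasCompactSupport f)
    (i : Fin n) : ∫ x, pd i f x = 0 := by
  have hcont : Continuous (pd i f) := by
    unfold pd
    exact (hf.continuous_fderiv (by simp)).clm_apply continuous_const
  have hc' : HasCompactSupport (pd i f) := hc.fderiv_apply ℝ _
  have := integral_mul_fderiv_eq_neg_fderiv_mul_of_integrable (μ := (volume : Measure (Fin n → ℝ)))
    (f := fun _ => (1 : ℝ)) (g := f) (v := Pi.single i 1) (by simp)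
    (by simp only [one_mul]; exact hcont.integrable_of_hasCompactSupport hc')
    (by simpa using hf.continuous.integrable_of_hasCompactSupport hc)
    (fun x _ => by fun_prop) (fun x _ => hf.differentiable (by simp) x)
  simpa [pd] using this

lemma contDiff_pd_one {f : (Fin n → ℝ) → ℝ} (hf : ContDiff ℝ 2 f) (i : Fin n) :
    ContDiff ℝ 1 (pd i f) := by
  unfold pd
  exact (hf.fderiv_right (m := 1) (by norm_num)).clm_apply contDiff_const

variable {F : (Fin n → ℝ) → ℝ} (hF : ContDiff ℝ ∞ F)
include hF

lemma integral_mul_lap (hP : ConstPhase F) {f ψ : (Fin n → ℝ) → ℝ} (hf : ContDiff ℝ ∞ f)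
    (hψ : ContDiff ℝ 2 ψ) (hc : HasCompactSupport ψ) :
    ∫ x, f x * lap F ψ x = ∫ x, ψ x * lap F f x := by
  have hf2 : ContDiff ℝ 2 f := hf.of_le two_le_infty
  have hf1 : ContDiff ℝ 1 f := hf.of_le (by exact_mod_cast le_top)
  have hψ1 : ContDiff ℝ 1 ψ := hψ.of_le (by norm_num)
  have hW (i j : Fin n) : ContDiff ℝ ∞ (fun x => volDensity F x * invMetric F x i j) :=
    (contDiff_volDensity hF).mul (contDiff_invMetric hF i j)
  have hW1 (i j : Fin n) : ContDiff ℝ 1 (fun x => volDensity F x * invMetric F x i j) :=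
    (hW i j).of_le (by exact_mod_cast le_top)
  have hB (j : Fin n) : ContDiff ℝ 1 (fun y => f y * pd j ψ y - ψ y * pd j f y) :=
    (hf1.mul (contDiff_pd_one hψ j)).sub (hψ1.mul (contDiff_pd_one hf2 j))
  have hBc (j : Fin n) : HasCompactSupport (fun y => f y * pd j ψ y - ψ y * pd j f y) := by
    have h1 : HasCompactSupport (pd j ψ) := hc.fderiv_apply ℝ _
    exact (h1.mul_left (f := f)).sub (hc.mul_right (f' := pd j f))
  have hV (i j : Fin n) : ContDiff ℝ 1 (fun y => volDensity F y * invMetric F y i j *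
      (f y * pd j ψ y - ψ y * pd j f y)) := (hW1 i j).mul (hB j)
  have hVc (i j : Fin n) : HasCompactSupport (fun y => volDensity F y * invMetric F y i j *
      (f y * pd j ψ y - ψ y * pd j f y)) :=
    (hBc j).mul_left (f := fun y => volDensity F y * invMetric F y i j)
  have hpt (x : Fin n → ℝ) : ∑ j, ∑ i, pd i (fun y => volDensity F y * invMetric F y i j *
      (f y * pd j ψ y - ψ y * pd j f y)) x = f x * lap F ψ x - ψ x * lap F f x := by
    have h1 (i j : Fin n) : pd i (fun y => volDensity F y * invMetric F y i j *
        (f y * pd j ψ y - ψ y * pd j f y)) x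
        = pd i (fun y => volDensity F y * invMetric F y i j) x *
            (f x * pd j ψ x - ψ x * pd j f x)
          + (volDensity F x * invMetric F x i j * (f x * pd i (pd j ψ) x - ψ x * pd i (pd j f) x)
          + volDensity F x * invMetric F x i j * (pd i f x * pd j ψ x - pd i ψ x * pd j f x)) := by
      have d1 := hf1.differentiable (by simp) x
      have d2 := hψ1.differentiable (by simp) x
      have d3 := (contDiff_pd_one hψ j).differentiable (by simp) x
      have d4 := (contDiff_pd_one hf2 j).differentiable (by simp) x
      rw [pd_mul i ((hW1 i j).differentiable (by simp) x) ((hB j).differentiable (by simp) x),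
        pd_sub i (d1.fun_mul d3) (d2.fun_mul d4), pd_mul i d1 d3, pd_mul i d2 d4]
      ring
    simp only [h1, Finset.sum_add_distrib, ← Finset.sum_mul,
      sum_pd_volDensity_mul_invMetric hF hP, zero_mul, zero_add]
    have hskew : ∑ j, ∑ i, volDensity F x * invMetric F x i j *
        (pd i f x * pd j ψ x - pd i ψ x * pd j f x) = 0 := by
      simp only [mul_sub, Finset.sum_sub_distrib]
      rw [sub_eq_zero]
      conv_rhs => rw [Finset.sum_comm]
      refine Finset.sum_congr rfl fun j _ => Finset.sum_congr rfl fun i _ => ?_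
      rw [invMetric_comm hF x i j]
      ring
    rw [hskew, add_zero]
    simp only [lap, mul_sub, Finset.sum_sub_distrib, Finset.mul_sum]
    congr 1 <;>
    · rw [Finset.sum_comm]
      refine Finset.sum_congr rfl fun j _ => Finset.sum_congr rfl fun i _ => ?_
      ring
  have hpdV (i j : Fin n) := ((hV i j).continuous_fderiv (by simp)).clm_apply
    (continuous_const (y := (Pi.single i 1 : Fin n → ℝ)))
  have hzero : ∫ x, (f x * lap F ψ x - ψ x * lap F f x) = 0 := by
    simp only [← hpt]
    have hInt (i j : Fin n) : Integrable (fun x => pd i (fun y => volDensity F y *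
        invMetric F y i j * (f y * pd j ψ y - ψ y * pd j f y)) x) :=
      (hpdV i j).integrable_of_hasCompactSupport ((hVc i j).fderiv_apply ℝ _)
    rw [integral_finsetSum _ fun j _ => integrable_finsetSum _ fun i _ => hInt i j]
    refine Finset.sum_eq_zero fun j _ => ?_
    rw [integral_finsetSum _ fun i _ => hInt i j]
    exact Finset.sum_eq_zero fun i _ => integral_pd_eq_zero (hV i j) (hVc i j) i
  have hlap {g : (Fin n → ℝ) → ℝ} (hg : ContDiff ℝ 2 g) : Continuous (lap F g) := by
    unfold lap
    refine continuous_finsetSum _ fun i _ => continuous_finsetSum _ fun j _ =>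
      (hW i j).continuous.mul ?_
    exact ((contDiff_pd_one hg j).continuous_fderiv (by simp)).clm_apply continuous_const
  have hlc : HasCompactSupport (lap F ψ) := by
    refine HasCompactSupport.intro hc.isCompact fun x hx => ?_
    refine Finset.sum_eq_zero fun i _ => Finset.sum_eq_zero fun j _ => ?_
    have h0 : pd i (pd j ψ) x = 0 := image_eq_zero_of_notMem_tsupport fun h =>
      hx (tsupport_fderiv_apply_subset ℝ _ (tsupport_fderiv_apply_subset ℝ _ h))
    rw [h0, mul_zero]
  rw [integral_sub] at hzero
  · exact sub_eq_zero.1 hzero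
  · exact (hf.continuous.mul (hlap hψ)).integrable_of_hasCompactSupport (hlc.mul_left (f := f))
  · exact (hψ.continuous.mul (hlap hf2)).integrable_of_hasCompactSupport
      (hc.mul_right (f' := lap F f))

end parts

section monotonicity
variable {n : ℕ}

/-- The scale-invariant smoothed integral of `f` over the part of the graph of `∇F` at distance
less than `R` from its point over `p`. -/
noncomputable def ballMean (F : (Fin n → ℝ) → ℝ) (p : Fin n → ℝ) (f : (Fin n → ℝ) → ℝ)
    (R : ℝ) : ℝ :=
  (∫ x, f x * (cutoff 3 ((R ^ 2)⁻¹ * distSq F p x) * volDensity F x)) / R ^ n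

variable {F : (Fin n → ℝ) → ℝ} (hF : ContDiff ℝ ∞ F)

lemma cutoff_distSq_eq_zero {k : ℕ} (hk : k ≠ 0) {a b : ℝ} (hb : 0 < b) (hab : b ≤ a)
    {p x : Fin n → ℝ} (hx : x ∉ Metric.closedBall p √b⁻¹) : cutoff k (a * distSq F p x) = 0 := by
  refine cutoff_eq_zero hk ?_
  rw [Metric.mem_closedBall, dist_eq_norm, not_le] at hx
  have h1 : b⁻¹ ≤ ‖x - p‖ ^ 2 := by
    rw [← Real.sq_sqrt (inv_nonneg.2 hb.le)]
    gcongr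
  have h2 := h1.trans (norm_sq_le_distSq (F := F) p x)
  calc 1 = b * b⁻¹ := (mul_inv_cancel₀ hb.ne').symm
    _ ≤ a * distSq F p x := by gcongr; exact hb.le.trans hab

lemma hasCompactSupport_cutoff {k : ℕ} (hk : k ≠ 0) {a : ℝ} (ha : 0 < a) (p : Fin n → ℝ) :
    HasCompactSupport fun x => cutoff k (a * distSq F p x) :=
  HasCompactSupport.intro (isCompact_closedBall p √a⁻¹)
    fun _ hx => cutoff_distSq_eq_zero hk ha le_rfl hx

include hF

lemma continuous_cutoff_distSq (k : ℕ) (a : ℝ) (p : Fin n → ℝ) :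
    Continuous fun x => cutoff k (a * distSq F p x) :=
  (continuous_cutoff k).comp (continuous_const.mul (contDiff_distSq hF p).continuous)

lemma integrable_cutoff_mul {k : ℕ} (hk : k ≠ 0) {a : ℝ} (ha : 0 < a) (p : Fin n → ℝ)
    {g : (Fin n → ℝ) → ℝ} (hg : Continuous g) :
    Integrable fun x => cutoff k (a * distSq F p x) * g x :=
  ((continuous_cutoff_distSq hF k a p).mul hg).integrable_of_hasCompactSupport
    ((hasCompactSupport_cutoff hk ha p).mul_right (f' := g))

lemma hasDerivAt_integral_cutoff (k : ℕ) (p : Fin n → ℝ)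
    {g : (Fin n → ℝ) → ℝ} (hg : Continuous g) {a : ℝ} (ha : 0 < a) :
    HasDerivAt (fun a => ∫ x, cutoff (k + 2) (a * distSq F p x) * g x)
      (∫ x, cutoff (k + 1) (a * distSq F p x) * (-(k + 2) * distSq F p x * g x)) a := by
  have hr : Continuous (distSq F p) := (contDiff_distSq hF p).continuous
  set B := Metric.closedBall p √(a / 2)⁻¹ with hB
  set b : (Fin n → ℝ) → ℝ := B.indicator fun x => |-(k + 2) * distSq F p x * g x| with hb
  have hbint : Integrable b := by
    rw [hb, integrable_indicator_iff Metric.isClosed_closedBall.measurableSet]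
    have : Continuous fun x => |-(k + 2 : ℝ) * distSq F p x * g x| :=
      ((continuous_const.mul hr).mul hg).abs
    exact this.continuousOn.integrableOn_compact (isCompact_closedBall _ _)
  refine (hasDerivAt_integral_of_dominated_loc_of_deriv_le (bound := b)
    (s := Set.Ioi (a / 2)) (F := fun a x => cutoff (k + 2) (a * distSq F p x) * g x)
    (F' := fun a x => cutoff (k + 1) (a * distSq F p x) * (-(k + 2) * distSq F p x * g x))
    (Ioi_mem_nhds (by linarith)) ?_ ?_ ?_ ?_ hbint ?_).2
  · exact Filter.Eventually.of_forall fun a =>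
      ((continuous_cutoff_distSq hF _ a p).mul hg).aestronglyMeasurable
  · exact integrable_cutoff_mul hF (by simp) ha p hg
  · exact ((continuous_cutoff_distSq hF _ a p).mul
      ((continuous_const.mul hr).mul hg)).aestronglyMeasurable
  · refine Filter.Eventually.of_forall fun x c hc => ?_
    by_cases hx : x ∈ B
    · rw [hb, Set.indicator_of_mem hx, norm_mul, Real.norm_eq_abs, Real.norm_eq_abs,
        abs_of_nonneg (cutoff_nonneg _ _)]
      refine mul_le_of_le_one_left (abs_nonneg _) (cutoff_le_one _ (mul_nonneg ?_
        (distSq_nonneg p x)))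
      exact (half_pos ha).le.trans (le_of_lt hc)
    · rw [cutoff_distSq_eq_zero (by simp) (half_pos ha) (le_of_lt hc) hx, zero_mul, norm_zero, hb,
        Set.indicator_of_notMem hx]
  · refine Filter.Eventually.of_forall fun x c _ => ?_
    have h1 := (hasDerivAt_cutoff k (c * distSq F p x)).comp c
      ((hasDerivAt_id c).mul_const (distSq F p x))
    refine (h1.mul_const (g x)).congr_deriv ?_
    ring

lemma integral_cutoff_mul_lap (hP : ConstPhase F) {f : (Fin n → ℝ) → ℝ} (hf : ContDiff ℝ ∞ f)
    (p : Fin n → ℝ) {a : ℝ} (ha : 0 < a) :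
    ∫ x, cutoff 4 (a * distSq F p x) / 16 * lap F f x =
      a ^ 2 * (∫ x, cutoff 2 (a * distSq F p x) * (3 * distSq F p x * (f x * volDensity F x)))
      - a ^ 2 * (∫ x, cutoff 2 (a * distSq F p x) *
        (3 * normalSq F p x * (f x * volDensity F x)))
      - n / 2 * a * (∫ x, cutoff 3 (a * distSq F p x) * (f x * volDensity F x)) := by
  have hr := contDiff_distSq hF p
  have hψ : ContDiff ℝ 2 fun x => cutoff 4 (a * distSq F p x) / 16 :=
    (((contDiff_cutoff 3).of_le (by exact_mod_cast (by norm_num : (2 : ℕ) ≤ 3))).comp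
      (contDiff_const.mul (hr.of_le two_le_infty))).div_const 16
  have hc : HasCompactSupport fun x => cutoff 4 (a * distSq F p x) / 16 :=
    HasCompactSupport.intro (isCompact_closedBall p √a⁻¹) fun x hx => by
      rw [cutoff_distSq_eq_zero (by simp) ha le_rfl hx, zero_div]
  rw [← integral_mul_lap hF hP hf hψ hc]
  have hd (k : ℕ) (c t : ℝ) : HasDerivAt (fun t => c * cutoff (k + 2) (a * t))
      (c * (-(k + 2) * cutoff (k + 1) (a * t) * a)) t := by
    have := (hasDerivAt_cutoff k (a * t)).comp t ((hasDerivAt_id t).const_mul a)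
    simpa using this.const_mul c
  have hlap (x : Fin n → ℝ) : lap F (fun x => cutoff 4 (a * distSq F p x) / 16) x
      = 3 / 4 * a ^ 2 * cutoff 2 (a * distSq F p x) *
          (4 * volDensity F x * (distSq F p x - normalSq F p x))
        + -(a / 4) * cutoff 3 (a * distSq F p x) * (2 * n * volDensity F x) := by
    rw [lap_comp (φ := fun t => cutoff 4 (a * t) / 16)
      (φ₁ := fun t => -(a / 4) * cutoff 3 (a * t))
      (φ₂ := fun t => 3 / 4 * a ^ 2 * cutoff 2 (a * t)) hr
      (fun t => ?_) (fun t => ?_), sum_pd_distSq_sq hF, lap_distSq hF hP]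
    · have := hd 2 (1 / 16) t
      simp only [div_eq_inv_mul]
      convert this using 1
      · norm_num
      · norm_num; ring
    · refine (hd 1 (-(a / 4)) t).congr_deriv ?_
      norm_num; ring
  have hω := (contDiff_volDensity hF).continuous
  have i1 := integrable_cutoff_mul hF two_ne_zero ha p
    (g := fun x => 3 * distSq F p x * (f x * volDensity F x))
    ((continuous_const.mul hr.continuous).mul (hf.continuous.mul hω))
  have i2 := integrable_cutoff_mul hF two_ne_zero ha p
    (g := fun x => 3 * normalSq F p x * (f x * volDensity F x))
    ((continuous_const.mul (continuous_normalSq hF p)).mul (hf.continuous.mul hω))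
  have i3 := integrable_cutoff_mul hF three_ne_zero ha p
    (g := fun x => f x * volDensity F x) (hf.continuous.mul hω)
  have i12 : Integrable fun x => a ^ 2 * (cutoff 2 (a * distSq F p x) *
      (3 * distSq F p x * (f x * volDensity F x))) - a ^ 2 * (cutoff 2 (a * distSq F p x) *
      (3 * normalSq F p x * (f x * volDensity F x))) := (i1.const_mul _).sub (i2.const_mul _)
  rw [← integral_const_mul, ← integral_const_mul, ← integral_const_mul,
    ← integral_sub (i1.const_mul _) (i2.const_mul _), ← integral_sub i12 (i3.const_mul _)]
  refine integral_congr_ae (Filter.Eventually.of_forall fun x => ?_)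
  simp only [hlap]
  ring

lemma hasDerivAt_ballMean (hP : ConstPhase F) {f : (Fin n → ℝ) → ℝ} (hf : ContDiff ℝ ∞ f)
    (p : Fin n → ℝ) {R : ℝ} (hR : 0 < R) :
    HasDerivAt (ballMean F p f) (2 * R / R ^ n *
      ((∫ x, cutoff 4 ((R ^ 2)⁻¹ * distSq F p x) / 16 * lap F f x) +
        ((R ^ 2)⁻¹) ^ 2 * (∫ x, cutoff 2 ((R ^ 2)⁻¹ * distSq F p x) *
        (3 * normalSq F p x * (f x * volDensity F x))))) R := by
  have hω := (contDiff_volDensity hF).continuous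
  have ha : 0 < (R ^ 2)⁻¹ := by positivity
  have h1 := hasDerivAt_integral_cutoff hF 1 p (g := fun x => f x * volDensity F x) (hf.continuous.mul hω) ha
  have h2 : HasDerivAt (fun R : ℝ => (R ^ 2)⁻¹) (-(2 * R) / (R ^ 2) ^ 2) R := by
    have := (hasDerivAt_pow 2 R).fun_inv (by positivity)
    simpa using this
  have h3 := h1.comp R h2
  have h4 := h3.div (hasDerivAt_pow n R) (by positivity)
  have e : ballMean F p f = fun R => (∫ x, cutoff 3 ((R ^ 2)⁻¹ * distSq F p x) *
      (f x * volDensity F x)) / R ^ n := by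
    funext R
    unfold ballMean
    congr 2
    funext x
    ring
  rw [e]
  refine h4.congr_deriv ?_
  rw [integral_cutoff_mul_lap hF hP hf p ha]
  have e2 : (∫ x, cutoff 2 ((R ^ 2)⁻¹ * distSq F p x) *
      (-((1 : ℕ) + 2) * distSq F p x * (f x * volDensity F x)))
      = -∫ x, cutoff 2 ((R ^ 2)⁻¹ * distSq F p x) *
        (3 * distSq F p x * (f x * volDensity F x)) := by
    rw [← integral_neg]
    congr 1
    funext x
    push_cast
    ring
  simp only [Function.comp_def]
  have e3 : (1 : ℕ) + 1 = 2 := rfl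
  have e4 : (1 : ℕ) + 2 = 3 := rfl
  rw [e3, e2, e4]
  generalize (∫ x, cutoff 2 ((R ^ 2)⁻¹ * distSq F p x) *
        (3 * distSq F p x * (f x * volDensity F x))) = A
  generalize (∫ x, cutoff 2 ((R ^ 2)⁻¹ * distSq F p x) *
        (3 * normalSq F p x * (f x * volDensity F x))) = B
  generalize (∫ x, cutoff 3 ((R ^ 2)⁻¹ * distSq F p x) * (f x * volDensity F x)) = I
  rcases n with _ | n
  · simp
    field_simp
  · simp only [Nat.add_sub_cancel]
    field_simp
    push_cast
    ring

end monotonicity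

section segments
variable {E V : Type*} [NormedAddCommGroup E] [NormedSpace ℝ E] [NormedAddCommGroup V]
  [NormedSpace ℝ V]

lemma enorm_sub_le_lintegral_fderiv {g : E → V} (hg : ContDiff ℝ 1 g) (x y : E) :
    ‖g x - g y‖ₑ ≤ ∫⁻ s in Set.Icc (0 : ℝ) 1, ‖fderiv ℝ g (y + s • (x - y))‖ₑ * ‖x - y‖ₑ := by
  have hl : ContDiff ℝ 1 fun s : ℝ => g (y + s • (x - y)) :=
    hg.comp (contDiff_const.add (contDiff_id.smul contDiff_const))
  have h := enorm_sub_le_lintegral_deriv_of_contDiffOn_Icc hl.contDiffOn (zero_le_one (α := ℝ))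
  simp only [one_smul, add_sub_cancel, zero_smul, add_zero] at h
  refine h.trans (lintegral_mono fun s => ?_)
  have hd : HasDerivAt (fun s : ℝ => y + s • (x - y)) (x - y) s := by
    simpa using ((hasDerivAt_id s).smul_const (x - y)).const_add y
  have hc : HasDerivAt (fun s : ℝ => g (y + s • (x - y)))
      (fderiv ℝ g (y + s • (x - y)) (x - y)) s :=
    (hg.differentiable one_ne_zero _).hasFDerivAt.comp_hasDerivAt s hd
  simp only [hc.deriv]
  exact ContinuousLinearMap.le_opENorm _ _

variable [MeasurableSpace E] [BorelSpace E] [FiniteDimensional ℝ E] (μ : Measure E)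
  [μ.IsAddHaarMeasure]

lemma lintegral_lintegral_segment_le {G : E → ENNReal} (hG : Continuous G) {s : ℝ}
    (hs : s ∈ Set.Icc (0 : ℝ) 1) :
    ∫⁻ y in Metric.closedBall 0 1, ∫⁻ x in Metric.closedBall 0 1, G (y + s • (x - y)) ∂μ ∂μ
      ≤ μ (Metric.closedBall 0 2) * ∫⁻ z in Metric.closedBall 0 3, G z ∂μ := by
  have hm {r : ℝ} : MeasurableSet (Metric.closedBall (0 : E) r) := Metric.isClosed_closedBall.measurableSet
  calc _ ≤ ∫⁻ y in Metric.closedBall 0 1, ∫⁻ u in Metric.closedBall 0 2, G (y + s • u) ∂μ ∂μ := by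
        refine setLIntegral_mono' hm fun y hy => ?_
        rw [← lintegral_indicator hm, ← lintegral_indicator hm,
          ← lintegral_add_right_eq_self _ y]
        refine lintegral_mono fun u => ?_
        by_cases hu : u + y ∈ Metric.closedBall (0 : E) 1
        · have hu2 : u ∈ Metric.closedBall (0 : E) 2 := by
            rw [mem_closedBall_zero_iff] at *
            calc ‖u‖ = ‖(u + y) - y‖ := by simp
              _ ≤ 2 := (norm_sub_le _ _).trans (by linarith)
          rw [Set.indicator_of_mem hu, Set.indicator_of_mem hu2, add_sub_cancel_right]
        · rw [Set.indicator_of_notMem hu]; exact zero_le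
    _ = ∫⁻ u in Metric.closedBall 0 2, ∫⁻ y in Metric.closedBall 0 1, G (y + s • u) ∂μ ∂μ :=
        lintegral_lintegral_swap (hG.comp (by fun_prop)).measurable.aemeasurable
    _ ≤ ∫⁻ _ in Metric.closedBall 0 2, ∫⁻ z in Metric.closedBall 0 3, G z ∂μ ∂μ := by
        refine setLIntegral_mono' hm fun u hu => ?_
        rw [← lintegral_indicator hm, ← lintegral_indicator hm,
          ← lintegral_add_right_eq_self (Set.indicator _ G) (s • u)]
        refine lintegral_mono fun y => ?_
        by_cases hy : y ∈ Metric.closedBall (0 : E) 1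
        · have hu2 : y + s • u ∈ Metric.closedBall (0 : E) 3 := by
            rw [mem_closedBall_zero_iff] at *
            have : ‖s • u‖ ≤ 2 := by
              rw [norm_smul, Real.norm_eq_abs, abs_of_nonneg hs.1]
              nlinarith [hs.1, hs.2, norm_nonneg u]
            exact (norm_add_le _ _).trans (by linarith)
          rw [Set.indicator_of_mem hy, Set.indicator_of_mem hu2]
        · rw [Set.indicator_of_notMem hy]; exact zero_le
    _ = _ := by rw [setLIntegral_const, mul_comm]

lemma lintegral_lintegral_enorm_sub_le {g : E → V} (hg : ContDiff ℝ 1 g) :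
    ∫⁻ y in Metric.closedBall 0 1, ∫⁻ x in Metric.closedBall 0 1, ‖g x - g y‖ₑ ∂μ ∂μ
      ≤ 2 * μ (Metric.closedBall 0 2) * ∫⁻ z in Metric.closedBall 0 3, ‖fderiv ℝ g z‖ₑ ∂μ := by
  have hm {r : ℝ} : MeasurableSet (Metric.closedBall (0 : E) r) := Metric.isClosed_closedBall.measurableSet
  have hG : Continuous fun z => 2 * ‖fderiv ℝ g z‖ₑ :=
    ENNReal.continuous_const_mul (by simp) |>.comp (hg.continuous_fderiv one_ne_zero).enorm
  have hG3 {X : Type _} [MeasurableSpace X] {φ : X → E} (hφ : Measurable φ) :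
    Measurable fun p => 2 * ‖fderiv ℝ g (φ p)‖ₑ := hG.measurable.comp hφ
  calc _ ≤ ∫⁻ y in Metric.closedBall 0 1, ∫⁻ x in Metric.closedBall 0 1,
          ∫⁻ s in Set.Icc (0 : ℝ) 1, 2 * ‖fderiv ℝ g (y + s • (x - y))‖ₑ ∂volume ∂μ ∂μ := by
        refine setLIntegral_mono' hm fun y hy => setLIntegral_mono' hm fun x hx => ?_
        refine (enorm_sub_le_lintegral_fderiv hg x y).trans (lintegral_mono fun s => ?_)
        rw [mul_comm]
        gcongr
        rw [mem_closedBall_zero_iff] at hx hy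
        rw [← ofReal_norm, show (2 : ENNReal) = ENNReal.ofReal 2 by simp]
        exact ENNReal.ofReal_le_ofReal ((norm_sub_le _ _).trans (by linarith))
    _ = ∫⁻ y in Metric.closedBall 0 1, ∫⁻ s in Set.Icc (0 : ℝ) 1,
          ∫⁻ x in Metric.closedBall 0 1, 2 * ‖fderiv ℝ g (y + s • (x - y))‖ₑ ∂μ ∂volume ∂μ := by
        refine lintegral_congr fun y => lintegral_lintegral_swap ?_
        exact (hG3 (φ := fun p : E × ℝ => y + p.2 • (p.1 - y)) (Continuous.measurable (by fun_prop))).aemeasurable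
    _ = ∫⁻ s in Set.Icc (0 : ℝ) 1, ∫⁻ y in Metric.closedBall 0 1,
          ∫⁻ x in Metric.closedBall 0 1, 2 * ‖fderiv ℝ g (y + s • (x - y))‖ₑ ∂μ ∂μ := by
        refine lintegral_lintegral_swap (Measurable.aemeasurable ?_)
        exact Measurable.lintegral_prod_right'
          (f := fun q : (E × ℝ) × E => 2 * ‖fderiv ℝ g (q.1.1 + q.1.2 • (q.2 - q.1.1))‖ₑ)
          (hG3 (Continuous.measurable (by fun_prop)))
    _ ≤ ∫⁻ s in Set.Icc (0 : ℝ) 1, μ (Metric.closedBall 0 2) *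
          ∫⁻ z in Metric.closedBall 0 3, 2 * ‖fderiv ℝ g z‖ₑ ∂μ :=
        setLIntegral_mono' measurableSet_Icc fun s hs => lintegral_lintegral_segment_le μ hG hs
    _ = _ := by
        rw [setLIntegral_const, Real.volume_Icc, sub_zero, ENNReal.ofReal_one, mul_one,
          lintegral_const_mul' _ _ (by simp)]
        ring

lemma setLIntegral_closedBall_smul_le {G : E → ENNReal} (hG : Measurable G) {s : ℝ} (hs0 : 0 < s)
    (hs1 : s ≤ 1) :
    ∫⁻ z in Metric.closedBall 0 1, G (s • z) ∂μ ≤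
      ENNReal.ofReal (s ^ Module.finrank ℝ E)⁻¹ * ∫⁻ z in Metric.closedBall 0 1, G z ∂μ := by
  have hm {r : ℝ} : MeasurableSet (Metric.closedBall (0 : E) r) := Metric.isClosed_closedBall.measurableSet
  have h := Measure.map_addHaar_smul μ hs0.ne'
  rw [abs_of_nonneg (by positivity)] at h
  rw [← smul_eq_mul, ← lintegral_smul_measure, ← Measure.restrict_smul, ← h,
    ← lintegral_indicator hm, ← lintegral_indicator hm, lintegral_map (hG.indicator hm) (by fun_prop)]
  refine lintegral_mono fun z => ?_
  by_cases hz : z ∈ Metric.closedBall (0 : E) 1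
  · have hz' : s • z ∈ Metric.closedBall (0 : E) 1 := by
      rw [mem_closedBall_zero_iff] at *
      rw [norm_smul, Real.norm_eq_abs, abs_of_pos hs0]
      nlinarith [norm_nonneg z]
    rw [Set.indicator_of_mem hz, Set.indicator_of_mem hz']
  · rw [Set.indicator_of_notMem hz]; exact zero_le

/-- A function whose derivative is close to zero in the mean is close in the mean to its value at
the origin. -/
lemma setLIntegral_enorm_sub_apply_zero_le {u : E → V} (hu : ContDiff ℝ 1 u) {C : NNReal}
    (hC : ∀ z, ‖fderiv ℝ u z‖ₑ ≤ C) {δ : ℝ} (hδ : 0 < δ) :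
    ∫⁻ z in Metric.closedBall 0 1, ‖u z - u 0‖ₑ ∂μ ≤
      ENNReal.ofReal δ * (C * μ (Metric.closedBall 0 1)) +
      ENNReal.ofReal (δ ^ Module.finrank ℝ E)⁻¹ *
        ∫⁻ z in Metric.closedBall 0 1, ‖fderiv ℝ u z‖ₑ ∂μ := by
  have hm {r : ℝ} : MeasurableSet (Metric.closedBall (0 : E) r) := Metric.isClosed_closedBall.measurableSet
  have hG : Measurable fun z => ‖fderiv ℝ u z‖ₑ := (hu.continuous_fderiv one_ne_zero).enorm.measurable
  calc _ ≤ ∫⁻ z in Metric.closedBall 0 1, ∫⁻ s in Set.Icc (0 : ℝ) 1,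
          ‖fderiv ℝ u (s • z)‖ₑ ∂volume ∂μ := by
        refine setLIntegral_mono' hm fun z hz => ?_
        refine (enorm_sub_le_lintegral_fderiv hu z 0).trans (lintegral_mono fun s => ?_)
        simp only [zero_add, sub_zero]
        refine mul_le_of_le_one_right' ?_
        rw [mem_closedBall_zero_iff] at hz
        rw [← ofReal_norm, ← ENNReal.ofReal_one]
        exact ENNReal.ofReal_le_ofReal hz
    _ = ∫⁻ s in Set.Icc (0 : ℝ) 1, ∫⁻ z in Metric.closedBall 0 1,
          ‖fderiv ℝ u (s • z)‖ₑ ∂μ := by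
        refine lintegral_lintegral_swap (Measurable.aemeasurable ?_)
        exact hG.comp (Continuous.measurable (f := fun p : E × ℝ => p.2 • p.1) (by fun_prop))
    _ ≤ (∫⁻ s in Set.Ico (0 : ℝ) δ, ∫⁻ z in Metric.closedBall 0 1, ‖fderiv ℝ u (s • z)‖ₑ ∂μ) +
        ∫⁻ s in Set.Icc δ 1, ∫⁻ z in Metric.closedBall 0 1, ‖fderiv ℝ u (s • z)‖ₑ ∂μ := by
        refine (lintegral_mono_set ?_).trans (lintegral_union_le _ _ _)
        intro s hs
        rcases lt_or_ge s δ with h | h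
        · exact Or.inl ⟨hs.1, h⟩
        · exact Or.inr ⟨h, hs.2⟩
    _ ≤ (∫⁻ _ in Set.Ico (0 : ℝ) δ, C * μ (Metric.closedBall 0 1)) +
        ∫⁻ _ in Set.Icc δ 1, ENNReal.ofReal (δ ^ Module.finrank ℝ E)⁻¹ *
          ∫⁻ z in Metric.closedBall 0 1, ‖fderiv ℝ u z‖ₑ ∂μ := by
        refine add_le_add (lintegral_mono fun s => ?_) ?_
        · rw [← setLIntegral_const]
          exact lintegral_mono fun z => hC _
        · refine setLIntegral_mono' measurableSet_Icc fun s hs => ?_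
          refine (setLIntegral_closedBall_smul_le μ hG (hδ.trans_le hs.1) hs.2).trans ?_
          gcongr
          exact hs.1
    _ ≤ _ := by
        rw [setLIntegral_const, setLIntegral_const, Real.volume_Ico, Real.volume_Icc, sub_zero,
          mul_comm (ENNReal.ofReal δ)]
        refine add_le_add le_rfl (mul_le_of_le_one_right' ?_)
        rw [← ENNReal.ofReal_one]
        exact ENNReal.ofReal_le_ofReal (by linarith)

end segments

section nearlyAffine

lemma exists_pos_mul_ofReal_le {A : ENNReal} (hA : A ≠ ⊤) {ε : ℝ} (hε : 0 < ε) :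
    ∃ η : ℝ, 0 < η ∧ A * ENNReal.ofReal η ≤ ENNReal.ofReal ε := by
  have h : 0 < A.toReal + 1 := by positivity
  refine ⟨ε / (A.toReal + 1), by positivity, ?_⟩
  rw [← ENNReal.ofReal_toReal hA, ← ENNReal.ofReal_mul ENNReal.toReal_nonneg,
    ENNReal.toReal_ofReal ENNReal.toReal_nonneg]
  refine ENNReal.ofReal_le_ofReal ?_
  rw [← mul_div_assoc, div_le_iff₀ h]
  nlinarith

variable {E : Type*} [NormedAddCommGroup E] [NormedSpace ℝ E]
  [MeasurableSpace E] [BorelSpace E] [FiniteDimensional ℝ E] (μ : Measure E)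
  [μ.IsAddHaarMeasure]

/-- A map with small second derivative in the mean is close in the mean to a linear map, to first
order. -/
lemma exists_linear_close (C : NNReal) {ε : ℝ} (hε : 0 < ε) :
    ∃ η : ℝ, 0 < η ∧ ∀ v : E → E, ContDiff ℝ 2 v → v 0 = 0 → (∀ z, ‖fderiv ℝ v z‖ ≤ C) →
      ∫⁻ z in Metric.closedBall 0 3, ‖fderiv ℝ (fderiv ℝ v) z‖ₑ ∂μ ≤ ENNReal.ofReal η →
      ∃ h : E →L[ℝ] E, ‖h‖ ≤ C ∧
        ∫⁻ z in Metric.closedBall 0 1, ‖v z - h z‖ₑ ∂μ ≤ ENNReal.ofReal ε ∧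
        ∫⁻ z in Metric.closedBall 0 1, ‖fderiv ℝ v z - h‖ₑ ∂μ ≤ ENNReal.ofReal ε := by
  have hB {r : ℝ} : μ (Metric.closedBall 0 r) ≠ ⊤ := (isCompact_closedBall _ _).measure_ne_top
  have hB1 : μ (Metric.closedBall 0 1) ≠ 0 :=
    (Metric.measure_closedBall_pos μ _ one_pos).ne'
  have h2C : (2 * C : ENNReal) * μ (Metric.closedBall (0 : E) 1) ≠ ⊤ :=
    ENNReal.mul_ne_top (by finiteness) hB
  obtain ⟨δ, hδ, hδε⟩ := exists_pos_mul_ofReal_le h2C (half_pos hε)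
  set c : ENNReal := (μ (Metric.closedBall 0 1))⁻¹ * (2 * μ (Metric.closedBall 0 2)) with hc
  have hct : c ≠ ⊤ := ENNReal.mul_ne_top (ENNReal.inv_ne_top.2 hB1)
    (ENNReal.mul_ne_top (by simp) hB)
  obtain ⟨η₁, hη₁, hη₁ε⟩ := exists_pos_mul_ofReal_le
    (ENNReal.mul_ne_top (ENNReal.ofReal_ne_top (r := (δ ^ Module.finrank ℝ E)⁻¹)) hct) (half_pos hε)
  obtain ⟨η₂, hη₂, hη₂ε⟩ := exists_pos_mul_ofReal_le hct hε
  refine ⟨min η₁ η₂, lt_min hη₁ hη₂, fun v hv hv0 hvC hD => ?_⟩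
  have hg : ContDiff ℝ 1 (fderiv ℝ v) := hv.fderiv_right (by norm_num)
  have hP := (lintegral_lintegral_enorm_sub_le μ hg).trans (mul_le_mul_right hD _)
  have hmeas : Measurable fun y => ∫⁻ x in Metric.closedBall 0 1, ‖fderiv ℝ v x - fderiv ℝ v y‖ₑ ∂μ := by
    refine Measurable.lintegral_prod_right'
      (f := fun q : E × E => ‖fderiv ℝ v q.2 - fderiv ℝ v q.1‖ₑ) ?_
    exact ((hg.continuous.comp continuous_snd).sub (hg.continuous.comp continuous_fst)).enorm.measurable
  obtain ⟨y, -, hy⟩ := exists_le_setLAverage hB1 hB hmeas.aemeasurable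
  rw [setLAverage_eq, ENNReal.div_eq_inv_mul] at hy
  have hy2 : ∫⁻ x in Metric.closedBall 0 1, ‖fderiv ℝ v x - fderiv ℝ v y‖ₑ ∂μ ≤
      c * ENNReal.ofReal (min η₁ η₂) := by
    refine hy.trans ?_
    rw [hc, mul_assoc]
    gcongr
  refine ⟨fderiv ℝ v y, hvC y, ?_, ?_⟩
  · have hu : ContDiff ℝ 1 fun z => v z - fderiv ℝ v y z :=
      (hv.of_le one_le_two).sub (fderiv ℝ v y).contDiff
    have hfd (z : E) : fderiv ℝ (fun z => v z - fderiv ℝ v y z) z = fderiv ℝ v z - fderiv ℝ v y := by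
      rw [fderiv_fun_sub (hv.differentiable two_ne_zero z) (fderiv ℝ v y).differentiableAt,
        ContinuousLinearMap.fderiv]
    have h := setLIntegral_enorm_sub_apply_zero_le μ hu (C := 2 * C) (fun z => ?_) hδ
    · simp only [hfd, hv0, map_zero, sub_zero] at h
      refine h.trans ?_
      rw [← add_halves ε, ENNReal.ofReal_add (by positivity) (by positivity)]
      refine add_le_add ?_ ?_
      · rw [mul_comm]; exact_mod_cast hδε
      · refine le_trans ?_ hη₁ε
        rw [mul_assoc]
        gcongr
        refine hy2.trans ?_
        gcongr
        exact min_le_left _ _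
    · rw [hfd, ← ofReal_norm]
      refine ENNReal.ofReal_le_of_le_toReal ?_
      simp only [ENNReal.coe_toReal]
      push_cast
      exact (norm_sub_le _ _).trans (by linarith [hvC z, hvC y])
  · refine (hy2.trans ?_).trans hη₂ε
    gcongr
    exact min_le_right _ _

end nearlyAffine

section graphIntegrand
variable {n : ℕ}

/-- The integrand computing the smoothed volume in the unit ball around the origin of a graph
passing at `z` through the point `(z, w)` with slope `h`. -/
noncomputable def graphIntegrand (q : (Fin n → ℝ) × (Fin n → ℝ) × ((Fin n → ℝ) →L[ℝ] (Fin n → ℝ))) :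
    ℝ :=
  cutoff 3 (∑ k, (q.1 k ^ 2 + q.2.1 k ^ 2)) *
    √((1 + (LinearMap.toMatrix' q.2.2.toLinearMap).transpose *
      LinearMap.toMatrix' q.2.2.toLinearMap).det)

lemma posDef_one_add_transpose_mul (A : Matrix (Fin n) (Fin n) ℝ) :
    (1 + A.transpose * A).PosDef := by
  have := Matrix.posSemidef_conjTranspose_mul_self A
  rw [Matrix.conjTranspose_eq_transpose_of_trivial] at this
  exact Matrix.PosDef.one.add_posSemidef this

lemma contDiff_graphIntegrand : ContDiff ℝ 1 (graphIntegrand (n := n)) := by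
  unfold graphIntegrand
  have h1 : ContDiff ℝ 1 (cutoff 3) := (contDiff_cutoff 2).of_le (by norm_num)
  refine (h1.comp ?_).mul (ContDiff.sqrt (contDiff_det fun i j => ?_) fun q =>
    (posDef_one_add_transpose_mul _).det_pos.ne')
  · fun_prop
  · simp only [Matrix.add_apply, Matrix.mul_apply, Matrix.transpose_apply, LinearMap.toMatrix'_apply,
      ContinuousLinearMap.coe_coe]
    fun_prop

lemma graphIntegrand_eq_zero {z w : Fin n → ℝ} {h : (Fin n → ℝ) →L[ℝ] (Fin n → ℝ)}
    (hz : z ∉ Metric.closedBall 0 1) : graphIntegrand (z, w, h) = 0 := by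
  rw [graphIntegrand, cutoff_eq_zero three_ne_zero, zero_mul]
  rw [mem_closedBall_zero_iff, not_le] at hz
  have h0 : 0 ≤ ∑ k, (z k ^ 2 + w k ^ 2) := Finset.sum_nonneg fun k _ => by positivity
  by_contra! hlt
  refine absurd ((pi_norm_le_iff_of_nonneg zero_le_one).2 fun k => ?_) (not_le.2 hz)
  rw [Real.norm_eq_abs, ← sq_le_one_iff_abs_le_one]
  have := Finset.single_le_sum (f := fun k => z k ^ 2 + w k ^ 2)
      (fun k _ => by positivity) (Finset.mem_univ k)
  nlinarith [sq_nonneg (w k)]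

open scoped MatrixOrder Matrix.Norms.L2Operator in
lemma exists_transpose_mul_eq {P : Matrix (Fin n) (Fin n) ℝ} (hP : P.PosSemidef) :
    ∃ S : Matrix (Fin n) (Fin n) ℝ, P = S.transpose * S := by
  obtain ⟨S, hS⟩ := CStarAlgebra.nonneg_iff_eq_star_mul_self.1 hP.nonneg
  exact ⟨S, by rwa [Matrix.star_eq_conjTranspose,
    Matrix.conjTranspose_eq_transpose_of_trivial] at hS⟩

lemma integral_graphIntegrand_linear (h : (Fin n → ℝ) →L[ℝ] (Fin n → ℝ)) :
    ∫ z, graphIntegrand (z, h z, h) = ∫ y : Fin n → ℝ, cutoff 3 (∑ k, y k ^ 2) := by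
  set A := LinearMap.toMatrix' h.toLinearMap with hA
  obtain ⟨S, hS⟩ := exists_transpose_mul_eq (posDef_one_add_transpose_mul A).posSemidef
  have hdet : (1 + A.transpose * A).det = S.det ^ 2 := by
    rw [hS, Matrix.det_mul, Matrix.det_transpose, sq]
  have hS0 : S.det ≠ 0 := fun h0 => by
    have := (posDef_one_add_transpose_mul A).det_pos
    rw [hdet, h0] at this
    simp at this
  have hq (z : Fin n → ℝ) : ∑ k, (z k ^ 2 + h z k ^ 2) = ∑ k, (Matrix.toLin' S z) k ^ 2 := by
    have e1 : h z = A.mulVec z := by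
      rw [← Matrix.toLin'_apply, hA, Matrix.toLin'_toMatrix']; rfl
    have e2 : z ⬝ᵥ ((1 + A.transpose * A).mulVec z) = z ⬝ᵥ ((S.transpose * S).mulVec z) := by
      rw [hS]
    have e3 (B : Matrix (Fin n) (Fin n) ℝ) :
        z ⬝ᵥ ((B.transpose * B).mulVec z) = B.mulVec z ⬝ᵥ B.mulVec z := by
      rw [← Matrix.mulVec_mulVec, Matrix.dotProduct_mulVec, Matrix.vecMul_transpose]
    rw [Matrix.add_mulVec, Matrix.one_mulVec, dotProduct_add, e3, e3] at e2
    rw [e1, Matrix.toLin'_apply]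
    simp only [sq, Finset.sum_add_distrib]
    exact e2
  have hφ : Continuous fun y : Fin n → ℝ => cutoff 3 (∑ k, y k ^ 2) :=
    (continuous_cutoff 3).comp (by fun_prop)
  have hT : Measurable (Matrix.toLin' S) := (LinearMap.continuous_of_finiteDimensional _).measurable
  have hmap := integral_map (μ := volume) hT.aemeasurable
    (f := fun y : Fin n → ℝ => cutoff 3 (∑ k, y k ^ 2)) hφ.aestronglyMeasurable
  rw [Real.map_matrix_volume_pi_eq_smul_volume_pi hS0, integral_smul_measure,
    ENNReal.toReal_ofReal (abs_nonneg _)] at hmap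
  have e : ∀ z, graphIntegrand (z, h z, h) = cutoff 3 (∑ k, (Matrix.toLin' S z) k ^ 2) * |S.det| := by
    intro z
    rw [graphIntegrand, ← hA, hdet, Real.sqrt_sq_eq_abs]
    simp only [hq]
  simp only [e]
  rw [integral_mul_const, ← hmap, abs_inv, smul_eq_mul, mul_comm, ← mul_assoc,
    mul_inv_cancel₀ (abs_ne_zero.2 hS0), one_mul]

/-- The smoothed volume in the unit ball of a graph with small second derivative is close to that
of a linear subspace. -/
lemma exists_abs_integral_graphIntegrand_sub_le (C : NNReal) {ε : ℝ} (hε : 0 < ε) :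
    ∃ η : ℝ, 0 < η ∧ ∀ v : (Fin n → ℝ) → (Fin n → ℝ), ContDiff ℝ 2 v → v 0 = 0 →
      (∀ z, ‖fderiv ℝ v z‖ ≤ C) →
      ∫⁻ z in Metric.closedBall 0 3, ‖fderiv ℝ (fderiv ℝ v) z‖ₑ ≤ ENNReal.ofReal η →
      |(∫ z, graphIntegrand (z, v z, fderiv ℝ v z)) -
        ∫ y : Fin n → ℝ, cutoff 3 (∑ k, y k ^ 2)| ≤ ε := by
  obtain ⟨L, hL⟩ := (contDiff_graphIntegrand (n := n)).locallyLipschitz.locallyLipschitzOn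
    |>.exists_lipschitzOnWith_of_compact (isCompact_closedBall 0 (max 1 C : ℝ))
  have hLA : (L * 2 : ENNReal) ≠ ⊤ := by finiteness
  obtain ⟨κ, hκ, hκε⟩ := exists_pos_mul_ofReal_le hLA hε
  obtain ⟨η, hη, H⟩ := exists_linear_close (volume : Measure (Fin n → ℝ)) C hκ
  refine ⟨η, hη, fun v hv hv0 hvC hD => ?_⟩
  obtain ⟨h, hhC, h1, h2⟩ := H v hv hv0 hvC hD
  rw [← integral_graphIntegrand_linear h]
  have hcd : Continuous (fderiv ℝ v) := hv.continuous_fderiv two_ne_zero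
  have hInt {w : (Fin n → ℝ) → (Fin n → ℝ)} {g : (Fin n → ℝ) → (Fin n → ℝ) →L[ℝ] (Fin n → ℝ)}
      (hw : Continuous w) (hg : Continuous g) : Integrable fun z => graphIntegrand (z, w z, g z) := by
    refine Continuous.integrable_of_hasCompactSupport
      (contDiff_graphIntegrand.continuous.comp (by fun_prop))
      (HasCompactSupport.intro (isCompact_closedBall 0 1) fun z hz => graphIntegrand_eq_zero hz)
  rw [← integral_sub (hInt hv.continuous hcd) (hInt h.continuous continuous_const),
    ← Real.norm_eq_abs, ← ENNReal.ofReal_le_ofReal_iff hε.le, ofReal_norm]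
  refine (enorm_integral_le_lintegral_enorm _).trans ?_
  have hm : MeasurableSet (Metric.closedBall (0 : Fin n → ℝ) 1) :=
    Metric.isClosed_closedBall.measurableSet
  have hmem {z w : Fin n → ℝ} {g : (Fin n → ℝ) →L[ℝ] (Fin n → ℝ)} (hz : z ∈ Metric.closedBall 0 1)
      (hw : ‖w‖ ≤ C) (hg : ‖g‖ ≤ C) : (z, w, g) ∈ Metric.closedBall
        (0 : (Fin n → ℝ) × (Fin n → ℝ) × ((Fin n → ℝ) →L[ℝ] (Fin n → ℝ))) (max 1 C : ℝ) := by
    rw [mem_closedBall_zero_iff] at *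
    exact max_le (hz.trans (le_max_left _ _))
      (max_le (hw.trans (le_max_right _ _)) (hg.trans (le_max_right _ _)))
  calc _ ≤ ∫⁻ z in Metric.closedBall 0 1, L * (‖v z - h z‖ₑ + ‖fderiv ℝ v z - h‖ₑ) := by
        rw [← lintegral_indicator hm]
        refine lintegral_mono fun z => ?_
        by_cases hz : z ∈ Metric.closedBall 0 1
        · have hz1 : ‖z‖ ≤ 1 := mem_closedBall_zero_iff.1 hz
          rw [Set.indicator_of_mem hz]
          have hvz : ‖v z‖ ≤ C := by
            have := Convex.norm_image_sub_le_of_norm_fderiv_le (𝕜 := ℝ) (f := v) (s := Set.univ)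
              (x := 0) (y := z) (fun x _ => hv.differentiable two_ne_zero x) (fun x _ => hvC x)
              convex_univ trivial trivial
            rw [hv0, sub_zero, sub_zero] at this
            exact this.trans (mul_le_of_le_one_right C.2 hz1)
          have hhz : ‖h z‖ ≤ C := (h.le_opNorm z).trans
            ((mul_le_of_le_one_right (norm_nonneg _) hz1).trans hhC)
          have := hL (hmem hz hvz (hvC z)) (hmem hz hhz hhC)
          rw [Prod.edist_eq, Prod.edist_eq, edist_self, edist_eq_enorm_sub, edist_eq_enorm_sub,
            edist_eq_enorm_sub] at this
          refine this.trans (mul_le_mul_right ?_ _)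
          exact max_le zero_le (max_le le_self_add le_add_self)
        · simp only [graphIntegrand_eq_zero hz, sub_self, enorm_zero, zero_le]
    _ = L * (∫⁻ z in Metric.closedBall 0 1, ‖v z - h z‖ₑ) +
        L * ∫⁻ z in Metric.closedBall 0 1, ‖fderiv ℝ v z - h‖ₑ := by
        rw [lintegral_const_mul' _ _ (by simp), lintegral_add_left, mul_add]
        exact (hv.continuous.sub h.continuous).enorm.measurable
    _ ≤ L * ENNReal.ofReal κ + L * ENNReal.ofReal κ := by gcongr
    _ = L * 2 * ENNReal.ofReal κ := by ring
    _ ≤ _ := hκε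

end graphIntegrand

section gradient
variable {n : ℕ}

/-- The gradient of `F`. -/
noncomputable def grad (F : (Fin n → ℝ) → ℝ) (x : Fin n → ℝ) : Fin n → ℝ := fun k => pd k F x

/-- The gradient graph of `F`, recentred at `p` and rescaled by `R⁻¹`. -/
noncomputable def rescale (F : (Fin n → ℝ) → ℝ) (p : Fin n → ℝ) (R : ℝ) (z : Fin n → ℝ) :
    Fin n → ℝ := R⁻¹ • (grad F (p + R • z) - grad F p)

lemma abs_entry_le {A : Matrix (Fin n) (Fin n) ℝ} (hA : A.IsHermitian) {K : ℝ}
    (hK : ∀ i, |hA.eigenvalues i| ≤ K) (i j : Fin n) : |A i j| ≤ n * K := by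
  have hU := entry_norm_bound_of_unitary hA.eigenvectorUnitary.2
  have h := congrFun (congrFun hA.spectral_theorem i) j
  rw [Unitary.conjStarAlgAut_apply, Matrix.mul_apply] at h
  rw [h]
  refine (Finset.abs_sum_le_sum_abs _ _).trans ?_
  calc _ ≤ ∑ _k : Fin n, K := Finset.sum_le_sum fun k _ => ?_
    _ = n * K := by simp
  rw [Matrix.mul_diagonal, abs_mul, abs_mul, Matrix.star_apply, star_trivial]
  have h1 := hU i k
  have h2 := hU j k
  rw [Real.norm_eq_abs] at h1 h2
  have h3 := hK k
  simp only [Function.comp_apply, RCLike.ofReal_real_eq_id, id]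
  have hK0 : 0 ≤ K := (abs_nonneg _).trans h3
  calc _ ≤ 1 * K * 1 := by gcongr
    _ = K := by ring

lemma norm_le_sum_norm_single {V : Type*} [NormedAddCommGroup V] [NormedSpace ℝ V]
    (L : (Fin n → ℝ) →L[ℝ] V) : ‖L‖ ≤ ∑ k, ‖L (Pi.single k 1)‖ := by
  refine L.opNorm_le_bound (Finset.sum_nonneg fun _ _ => norm_nonneg _) fun u => ?_
  conv_lhs => rw [pi_eq_sum_univ' u, map_sum]
  rw [Finset.sum_mul]
  refine (norm_sum_le _ _).trans (Finset.sum_le_sum fun k _ => ?_)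
  rw [map_smul, norm_smul, mul_comm]
  gcongr
  exact norm_le_pi_norm u k

lemma norm_le_sum_abs (u : Fin n → ℝ) : ‖u‖ ≤ ∑ k, |u k| :=
  (pi_norm_le_iff_of_nonneg (Finset.sum_nonneg fun _ _ => abs_nonneg _)).2 fun k =>
    Finset.single_le_sum (f := fun k => |u k|) (fun _ _ => abs_nonneg _) (Finset.mem_univ k)

variable {F : (Fin n → ℝ) → ℝ} (hF : ContDiff ℝ ∞ F)
include hF

lemma contDiff_grad : ContDiff ℝ ∞ (grad F) := contDiff_pi.2 fun k => contDiff_pd hF k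

lemma fderiv_grad_single (x : Fin n → ℝ) (j k : Fin n) :
    fderiv ℝ (grad F) x (Pi.single j 1) k = Hess n F x j k := by
  have h := fderiv_apply ((contDiff_grad hF).differentiable (by simp) x) k
  have := DFunLike.congr_fun h (Pi.single j 1)
  exact this.symm

lemma toMatrix'_fderiv_grad (x : Fin n → ℝ) :
    LinearMap.toMatrix' (fderiv ℝ (grad F) x).toLinearMap = Hess n F x := by
  ext k j
  rw [LinearMap.toMatrix'_apply, Hess_comm hF]
  exact fderiv_grad_single hF x j k

lemma norm_fderiv_grad_le {K : ℝ}
    (hbdd : ∀ x i, |(Hess_isHermitian hF x).eigenvalues i| ≤ K) (x : Fin n → ℝ) :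
    ‖fderiv ℝ (grad F) x‖ ≤ n * (n * (n * K)) := by
  calc _ ≤ _ := norm_le_sum_norm_single _
    _ ≤ ∑ _k : Fin n, n * (n * K) := Finset.sum_le_sum fun k _ => ?_
    _ = _ := by simp
  calc _ ≤ _ := norm_le_sum_abs _
    _ ≤ ∑ _k : Fin n, n * K := Finset.sum_le_sum fun j _ => ?_
    _ = _ := by simp
  rw [fderiv_grad_single hF]
  exact abs_entry_le _ (hbdd x) _ _

lemma norm_fderiv_fderiv_grad_le (x : Fin n → ℝ) :
    ‖fderiv ℝ (fderiv ℝ (grad F)) x‖ ≤ ∑ k, ∑ i, ∑ j, |mpd k (Hess n F) x i j| := by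
  have hg : ContDiff ℝ 1 (fderiv ℝ (grad F)) := (contDiff_grad hF).fderiv_right
    (by rw [one_add_one_eq_two]; exact two_le_infty)
  refine (norm_le_sum_norm_single _).trans (Finset.sum_le_sum fun k _ => ?_)
  refine (norm_le_sum_norm_single _).trans (Finset.sum_le_sum fun i _ => ?_)
  refine (norm_le_sum_abs _).trans (Finset.sum_le_sum fun j _ => le_of_eq ?_)
  congr 1
  have h1 : HasFDerivAt (fun y => fderiv ℝ (grad F) y (Pi.single i 1))
      ((fderiv ℝ (fderiv ℝ (grad F)) x).flip (Pi.single i 1)) x := by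
    have := (hg.differentiable one_ne_zero x).hasFDerivAt.clm_apply
      (hasFDerivAt_const (Pi.single i (1 : ℝ) : Fin n → ℝ) x)
    simpa using this
  have h2 := (hasFDerivAt_pi'.1 h1) j
  simp only [fderiv_grad_single hF] at h2
  rw [mpd, pd, h2.fderiv]
  rfl

lemma norm_sq_grad_sub_le {C : ℝ} (hC : ∀ x, ‖fderiv ℝ (grad F) x‖ ≤ C) (p x : Fin n → ℝ) :
    distSq F p x ≤ n * (1 + C ^ 2) * ‖x - p‖ ^ 2 := by
  have hg : ‖grad F x - grad F p‖ ≤ C * ‖x - p‖ :=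
    Convex.norm_image_sub_le_of_norm_fderiv_le (𝕜 := ℝ) (s := Set.univ)
      (fun x _ => (contDiff_grad hF).differentiable (by simp) x) (fun x _ => hC x)
      convex_univ trivial trivial
  unfold distSq
  calc _ ≤ ∑ _k : Fin n, (‖x - p‖ ^ 2 + (C * ‖x - p‖) ^ 2) := Finset.sum_le_sum fun k _ => ?_
    _ = _ := by simp; ring
  have h1 := norm_le_pi_norm (x - p) k
  have h2 := (norm_le_pi_norm (grad F x - grad F p) k).trans hg
  rw [Real.norm_eq_abs] at h1 h2
  refine add_le_add (sq_le_sq' (neg_le_of_abs_le h1) (le_of_abs_le h1))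
    (sq_le_sq' (neg_le_of_abs_le h2) (le_of_abs_le h2))

lemma contDiff_rescale (p : Fin n → ℝ) (R : ℝ) : ContDiff ℝ ∞ (rescale F p R) := by
  unfold rescale
  have := (contDiff_grad hF).comp
    (by fun_prop : ContDiff ℝ ∞ fun z : Fin n → ℝ => p + R • z)
  exact (this.sub contDiff_const).const_smul R⁻¹

lemma fderiv_rescale (p : Fin n → ℝ) {R : ℝ} (hR : R ≠ 0) :
    fderiv ℝ (rescale F p R) = fun z => fderiv ℝ (grad F) (p + R • z) := by
  funext z
  have h1 : HasFDerivAt (fun z : Fin n → ℝ => p + R • z)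
      (R • ContinuousLinearMap.id ℝ (Fin n → ℝ)) z :=
    ((hasFDerivAt_id z).const_smul R).const_add p
  have h2 := (((contDiff_grad hF).differentiable (by simp) (p + R • z)).hasFDerivAt.comp z
    h1).sub_const (grad F p) |>.const_smul R⁻¹
  refine h2.fderiv.trans ?_
  ext u
  simp [hR]

lemma fderiv_fderiv_rescale (p : Fin n → ℝ) {R : ℝ} (hR : R ≠ 0) (z : Fin n → ℝ) :
    fderiv ℝ (fderiv ℝ (rescale F p R)) z = R • fderiv ℝ (fderiv ℝ (grad F)) (p + R • z) := by
  rw [fderiv_rescale hF p hR]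
  have hg : ContDiff ℝ 1 (fderiv ℝ (grad F)) := (contDiff_grad hF).fderiv_right
    (by rw [one_add_one_eq_two]; exact two_le_infty)
  have h1 : HasFDerivAt (fun z : Fin n → ℝ => p + R • z)
      (R • ContinuousLinearMap.id ℝ (Fin n → ℝ)) z :=
    ((hasFDerivAt_id z).const_smul R).const_add p
  refine ((hg.differentiable one_ne_zero (p + R • z)).hasFDerivAt.comp z h1).fderiv.trans ?_
  ext u
  simp

omit hF in
lemma integral_comp_add_smul (f : (Fin n → ℝ) → ℝ) (p : Fin n → ℝ) {R : ℝ} (hR : 0 < R) :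
    ∫ z, f (p + R • z) = (∫ x, f x) / R ^ n := by
  rw [Measure.integral_comp_smul volume (fun x => f (p + x)), integral_add_left_eq_self,
    Module.finrank_fin_fun, abs_of_pos (by positivity), smul_eq_mul, inv_mul_eq_div]

lemma ballMean_one_eq (p : Fin n → ℝ) {R : ℝ} (hR : 0 < R) :
    ballMean F p (fun _ => 1) R =
      ∫ z, graphIntegrand (z, rescale F p R z, fderiv ℝ (rescale F p R) z) := by
  rw [ballMean, ← integral_comp_add_smul _ p hR]
  congr 1
  funext z
  rw [fderiv_rescale hF p hR.ne', graphIntegrand, toMatrix'_fderiv_grad hF, one_mul, volDensity,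
    Hess_transpose hF]
  congr 2
  simp only [distSq, rescale, Finset.mul_sum]
  refine Finset.sum_congr rfl fun k _ => ?_
  simp only [Pi.add_apply, Pi.smul_apply, Pi.sub_apply, smul_eq_mul, add_sub_cancel_left, grad]
  field_simp

end gradient

section growth

/-- A function bounded above whose logarithmic derivative in the scale is at least `2 * A` forces `A`
to be small at arbitrarily large scales. -/
lemma exists_ge_lt_of_hasDerivAt {Φ Φ' A : ℝ → ℝ} {M : ℝ}
    (hΦ : ∀ R, 0 < R → HasDerivAt Φ (Φ' R) R) (hA : ∀ R, 0 < R → 2 / R * A R ≤ Φ' R)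
    (hM : ∀ R, 0 < R → Φ R ≤ M) {δ R₀ : ℝ} (hδ : 0 < δ) (hR₀ : 0 < R₀) :
    ∃ R, R₀ ≤ R ∧ A R < δ := by
  by_contra! H
  have hd (R : ℝ) (hR : 0 < R) :
      HasDerivAt (fun R => Φ R - 2 * δ * Real.log R) (Φ' R - 2 * δ * R⁻¹) R :=
    (hΦ R hR).sub ((Real.hasDerivAt_log hR.ne').const_mul _)
  have hmono : MonotoneOn (fun R => Φ R - 2 * δ * Real.log R) (Set.Ici R₀) := by
    refine monotoneOn_of_deriv_nonneg (convex_Ici _)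
      (fun R hR => (hd R (hR₀.trans_le hR)).continuousAt.continuousWithinAt)
      (fun R hR => (hd R (hR₀.trans_le (interior_subset hR))).differentiableAt.differentiableWithinAt)
      (fun R hR => ?_)
    have hR' := interior_subset hR
    have hR1 : 0 < R := hR₀.trans_le hR'
    rw [(hd R hR1).deriv]
    have h1 := hA R hR1
    have h2 : 2 * δ * R⁻¹ ≤ 2 / R * A R := by
      rw [div_mul_eq_mul_div, ← div_eq_mul_inv]
      have := H R hR'
      gcongr
    linarith
  set t := (|M - Φ R₀| + 1) / (2 * δ) with ht
  have ht0 : 0 < t := by positivity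
  have hge : R₀ ≤ R₀ * Real.exp t := le_mul_of_one_le_right hR₀.le (Real.one_le_exp ht0.le)
  have h1 := hmono (Set.self_mem_Ici) hge hge
  simp only [Real.log_mul hR₀.ne' (Real.exp_pos t).ne', Real.log_exp] at h1
  have h2 := hM _ (hR₀.trans_le hge)
  have h3 : 2 * δ * t = |M - Φ R₀| + 1 := by rw [ht]; field_simp
  have h4 := le_abs_self (M - Φ R₀)
  linarith

variable {n : ℕ} {F : (Fin n → ℝ) → ℝ} (hF : ContDiff ℝ ∞ F) (hP : ConstPhase F)

lemma lap_const (c : ℝ) (x : Fin n → ℝ) : lap F (fun _ => c) x = 0 := by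
  have h (j : Fin n) : pd j (fun _ : Fin n → ℝ => c) = fun _ => 0 := by
    funext y; simp [pd]
  simp only [lap, h]
  simp [pd]

include hF

lemma volDensity_sq_le {K : ℝ} (hbdd : ∀ x i, |(Hess_isHermitian hF x).eigenvalues i| ≤ K)
    (x : Fin n → ℝ) : volDensity F x ^ 2 ≤ (1 + K ^ 2) ^ n := by
  rw [volDensity, Real.sq_sqrt (zero_le_one.trans (one_le_det hF x)),
    det_one_add_sq (Hess_isHermitian hF x)]
  calc _ ≤ ∏ _i : Fin n, (1 + K ^ 2) := Finset.prod_le_prod (fun i _ => by positivity) fun i _ => ?_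
    _ = _ := by simp
  have := sq_le_sq' (neg_le_of_abs_le (hbdd x i)) (le_of_abs_le (hbdd x i))
  gcongr

lemma ballMean_le {f : (Fin n → ℝ) → ℝ} (hf : Continuous f) {B W : ℝ}
    (hf0 : ∀ x, 0 ≤ f x) (hfB : ∀ x, f x ≤ B)
    (hW : ∀ x, volDensity F x ≤ W) (p : Fin n → ℝ) {R : ℝ} (hR : 0 < R) :
    ballMean F p f R ≤ B * W * 2 ^ n := by
  have hB : 0 ≤ B := (hf0 0).trans (hfB 0)
  have hW0 : 0 ≤ W := (volDensity_pos hF 0).le.trans (hW 0)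
  have ha : 0 < (R ^ 2)⁻¹ := by positivity
  rw [ballMean, div_le_iff₀ (by positivity)]
  have hR2 : √((R ^ 2)⁻¹)⁻¹ = R := by rw [inv_inv, Real.sqrt_sq hR.le]
  have hm : MeasurableSet (Metric.closedBall p R) := Metric.isClosed_closedBall.measurableSet
  have hvol : volume.real (Metric.closedBall p R) = (2 * R) ^ n := by
    rw [Measure.real, Real.volume_pi_closedBall p hR.le, ENNReal.toReal_ofReal (by positivity)]
    simp
  calc _ ≤ ∫ x, (Metric.closedBall p R).indicator (fun _ => B * W) x := by
        refine integral_mono ?_ ?_ fun x => ?_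
        · have := integrable_cutoff_mul hF three_ne_zero ha p
            (hf.mul (contDiff_volDensity hF).continuous)
          refine this.congr (Filter.Eventually.of_forall fun x => ?_)
          simp only [Pi.mul_apply]
          ring
        · rw [integrable_indicator_iff hm]
          exact integrableOn_const (isCompact_closedBall _ _).measure_ne_top
        · by_cases hx : x ∈ Metric.closedBall p R
          · rw [Set.indicator_of_mem hx]
            have h1 := cutoff_le_one 3 (mul_nonneg ha.le (distSq_nonneg (F := F) p x))
            have h2 := cutoff_nonneg 3 ((R ^ 2)⁻¹ * distSq F p x)
            have h3 := (volDensity_pos hF x).le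
            calc _ ≤ B * (1 * W) := by
                  gcongr
                  · exact hfB x
                  · exact hW x
              _ = _ := by ring
          · rw [cutoff_distSq_eq_zero three_ne_zero ha le_rfl (by rwa [hR2]), zero_mul, mul_zero,
              Set.indicator_of_notMem hx]
    _ = _ := by
        rw [integral_indicator hm, setIntegral_const, hvol, smul_eq_mul]
        ring

lemma le_deriv_ballMean {f : (Fin n → ℝ) → ℝ} (hf0 : ∀ x, 0 ≤ f x)
    (p : Fin n → ℝ) {R : ℝ} (hR : 0 < R) :
    2 / R * (R ^ 2 / R ^ n * ∫ x, cutoff 4 ((R ^ 2)⁻¹ * distSq F p x) / 16 * lap F f x) ≤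
      2 * R / R ^ n *
      ((∫ x, cutoff 4 ((R ^ 2)⁻¹ * distSq F p x) / 16 * lap F f x) +
        ((R ^ 2)⁻¹) ^ 2 * (∫ x, cutoff 2 ((R ^ 2)⁻¹ * distSq F p x) *
        (3 * normalSq F p x * (f x * volDensity F x)))) := by
  have h : 0 ≤ ∫ x, cutoff 2 ((R ^ 2)⁻¹ * distSq F p x) *
      (3 * normalSq F p x * (f x * volDensity F x)) := by
    refine integral_nonneg fun x => ?_
    have h1 := cutoff_nonneg 2 ((R ^ 2)⁻¹ * distSq F p x)
    have h2 := normalSq_nonneg hF p x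
    have h3 := hf0 x
    have h4 := (volDensity_pos hF x).le
    positivity
  have e : 2 / R * (R ^ 2 / R ^ n * ∫ x, cutoff 4 ((R ^ 2)⁻¹ * distSq F p x) / 16 * lap F f x) =
      2 * R / R ^ n * (∫ x, cutoff 4 ((R ^ 2)⁻¹ * distSq F p x) / 16 * lap F f x) := by
    field_simp
  rw [e]
  refine mul_le_mul_of_nonneg_left ?_ (by positivity)
  have : 0 ≤ ((R ^ 2)⁻¹) ^ 2 * (∫ x, cutoff 2 ((R ^ 2)⁻¹ * distSq F p x) *
        (3 * normalSq F p x * (f x * volDensity F x))) := by positivity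
  linarith

include hP

lemma monotoneOn_ballMean_one (p : Fin n → ℝ) :
    MonotoneOn (ballMean F p fun _ => 1) (Set.Ioi 0) := by
  have hd (R : ℝ) (hR : 0 < R) := hasDerivAt_ballMean hF hP (f := fun _ => 1) contDiff_const p hR
  refine monotoneOn_of_deriv_nonneg (convex_Ioi _)
    (fun R hR => (hd R hR).continuousAt.continuousWithinAt)
    (fun R hR => (hd R (interior_subset hR)).differentiableAt.differentiableWithinAt)
    (fun R hR => ?_)
  have hR := interior_subset hR
  rw [(hd R hR).deriv]
  refine le_trans (le_of_eq ?_) (le_deriv_ballMean hF (fun _ => zero_le_one) p hR)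
  simp only [lap_const, mul_zero, integral_zero]

/-- Rigidity in the monotonicity formula. -/
lemma Hess_eq_of_ballMean_eqOn {c : (Fin n → ℝ) → ℝ}
    (hc : ∀ p, ∀ R, 0 < R → ballMean F p (fun _ => 1) R = c p) (x y : Fin n → ℝ) :
    Hess n F x = Hess n F y := by
  have hN (p x : Fin n → ℝ) : normalSq F p x = 0 := by
    set R := √(distSq F p x + 1) with hR
    have hd0 := distSq_nonneg (F := F) p x
    have hR0 : 0 < R := Real.sqrt_pos.2 (by linarith)
    have hR2 : R ^ 2 = distSq F p x + 1 := Real.sq_sqrt (by linarith)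
    have h1 := hasDerivAt_ballMean hF hP (f := fun _ => 1) contDiff_const p hR0
    have h2 : HasDerivAt (ballMean F p fun _ => 1) 0 R := by
      refine (hasDerivAt_const R (c p)).congr_of_eventuallyEq ?_
      filter_upwards [Ioi_mem_nhds hR0] with r hr using hc p r hr
    have h3 := h1.unique h2
    simp only [lap_const, mul_zero, integral_zero, zero_add, one_mul] at h3
    have h4 : ∫ z, cutoff 2 ((R ^ 2)⁻¹ * distSq F p z) *
        (3 * normalSq F p z * volDensity F z) = 0 := by
      have e1 : 2 * R / R ^ n ≠ 0 := by positivity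
      have e2 : ((R ^ 2)⁻¹) ^ 2 ≠ 0 := by positivity
      simpa [e1, e2, hR0.ne'] using h3
    by_contra hne
    have ha : 0 < (R ^ 2)⁻¹ := by positivity
    refine absurd h4 (ne_of_gt (Continuous.integral_pos_of_hasCompactSupport_nonneg_nonzero
      (x := x) ?_ ?_ (fun z => ?_) ?_))
    · exact (continuous_cutoff_distSq hF _ _ p).mul ((continuous_const.mul
        (continuous_normalSq hF p)).mul (contDiff_volDensity hF).continuous)
    · exact (hasCompactSupport_cutoff two_ne_zero ha p).mul_right
        (f' := fun z => 3 * normalSq F p z * volDensity F z)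
    · have h1 := cutoff_nonneg 2 ((R ^ 2)⁻¹ * distSq F p z)
      have h2 := normalSq_nonneg hF p z
      have h4 := (volDensity_pos hF z).le
      simp only [Pi.zero_apply]
      positivity
    · refine mul_ne_zero (cutoff_pos _ ?_).ne'
        (mul_ne_zero (mul_ne_zero three_ne_zero hne) (volDensity_pos hF x).ne')
      rw [hR2, inv_mul_lt_iff₀ (by linarith)]
      linarith
  have hlin (p x : Fin n → ℝ) (k : Fin n) :
      pd k F p = pd k F x - (Hess n F x).mulVec (x - p) k := by
    have := congrFun (homDefect_eq_zero hF (hN p x)) k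
    simp only [homDefect, Pi.zero_apply] at this
    linarith
  have hH (p x : Fin n → ℝ) (j k : Fin n) : Hess n F p j k = Hess n F x k j := by
    have e : pd k F = fun p => pd k F x - (Hess n F x).mulVec (x - p) k := funext fun p => hlin p x k
    have hd : HasFDerivAt (fun p => pd k F x - (Hess n F x).mulVec (x - p) k)
        (((ContinuousLinearMap.proj k).comp
          (LinearMap.toContinuousLinearMap (Matrix.mulVecLin (Hess n F x))) :
          (Fin n → ℝ) →L[ℝ] ℝ)) p := by
      have h1 := (((ContinuousLinearMap.proj k).comp
          (LinearMap.toContinuousLinearMap (Matrix.mulVecLin (Hess n F x))) :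
          (Fin n → ℝ) →L[ℝ] ℝ)).hasFDerivAt.comp p ((hasFDerivAt_id p).const_sub x)
      have h2 := h1.const_sub (pd k F x)
      refine h2.congr_fderiv ?_
      ext u
      simp
    have : Hess n F p j k = fderiv ℝ (pd k F) p (Pi.single j 1) := rfl
    rw [this, e, hd.fderiv]
    simp
  ext i j
  rw [hH x y, hH y y]

end growth

set_option maxSynthPendingDepth 3 in
lemma norm_smul_bilinear {E : Type*} [NormedAddCommGroup E] [NormedSpace ℝ E] {R : ℝ} (hR : 0 < R)
    (A : E →L[ℝ] E →L[ℝ] E) : ‖R • A‖ = R * ‖A‖ := by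
  rw [norm_smul, Real.norm_eq_abs, abs_of_pos hR]

section density
variable {n : ℕ} {F : (Fin n → ℝ) → ℝ} (hF : ContDiff ℝ ∞ F) {K : ℝ}
  (hbdd : ∀ x i, |(Hess_isHermitian hF x).eigenvalues i| ≤ K)
include hF hbdd

lemma exists_abs_ballMean_one_sub_le {ε : ℝ} (hε : 0 < ε) :
    ∃ η : ℝ, 0 < η ∧ ∀ (p : Fin n → ℝ) (R : ℝ), 0 < R →
      ∫⁻ z in Metric.closedBall 0 3, ‖R • fderiv ℝ (fderiv ℝ (grad F)) (p + R • z)‖ₑ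
        ≤ ENNReal.ofReal η →
      |ballMean F p (fun _ => 1) R - ∫ y : Fin n → ℝ, cutoff 3 (∑ k, y k ^ 2)| ≤ ε := by
  obtain ⟨η, hη, H⟩ := exists_abs_integral_graphIntegrand_sub_le (n := n)
    (n * (n * (n * K))).toNNReal hε
  refine ⟨η, hη, fun p R hR h => ?_⟩
  rw [ballMean_one_eq hF p hR]
  refine H _ ((contDiff_rescale hF p R).of_le two_le_infty) (by simp [rescale]) (fun z => ?_) ?_
  · rw [fderiv_rescale hF p hR.ne']
    exact (norm_fderiv_grad_le hF hbdd _).trans (Real.le_coe_toNNReal _)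
  · simpa only [fderiv_fderiv_rescale hF p hR.ne'] using h

lemma exists_abs_ballMean_one_sub_le_of_le (p : Fin n → ℝ) {ε : ℝ} (hε : 0 < ε) :
    ∃ R₀ : ℝ, 0 < R₀ ∧ ∀ R, 0 < R → R ≤ R₀ →
      |ballMean F p (fun _ => 1) R - ∫ y : Fin n → ℝ, cutoff 3 (∑ k, y k ^ 2)| ≤ ε := by
  obtain ⟨η, hη, H⟩ := exists_abs_ballMean_one_sub_le hF hbdd hε
  have hcont : Continuous fun x => ‖fderiv ℝ (fderiv ℝ (grad F)) x‖ := by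
    have hg : ContDiff ℝ 1 (fderiv ℝ (grad F)) := (contDiff_grad hF).fderiv_right
      (by rw [one_add_one_eq_two]; exact two_le_infty)
    exact (hg.continuous_fderiv one_ne_zero).norm
  obtain ⟨M, hM⟩ := (isCompact_closedBall p 3).bddAbove_image hcont.continuousOn
  have hM' {x : Fin n → ℝ} (hx : x ∈ Metric.closedBall p 3) :
      ‖fderiv ℝ (fderiv ℝ (grad F)) x‖ ≤ M := hM ⟨x, hx, rfl⟩
  have hV : ENNReal.ofReal M * volume (Metric.closedBall (0 : Fin n → ℝ) 3) ≠ ⊤ :=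
    ENNReal.mul_ne_top ENNReal.ofReal_ne_top (isCompact_closedBall _ _).measure_ne_top
  obtain ⟨R₁, hR₁, hR₁η⟩ := exists_pos_mul_ofReal_le hV hη
  refine ⟨min R₁ 1, lt_min hR₁ one_pos, fun R hR hRle => H p R hR ?_⟩
  calc _ ≤ ∫⁻ _ in Metric.closedBall (0 : Fin n → ℝ) 3, ENNReal.ofReal M * ENNReal.ofReal R₁ := by
        refine setLIntegral_mono' Metric.isClosed_closedBall.measurableSet fun z hz => ?_
        have hM0 : 0 ≤ M :=
          le_trans (norm_nonneg (fderiv ℝ (fderiv ℝ (grad F)) p))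
            (hM' (Metric.mem_closedBall_self (by norm_num)))
        rw [← ofReal_norm, ← ENNReal.ofReal_mul hM0, norm_smul_bilinear hR, mul_comm]
        refine ENNReal.ofReal_le_ofReal (mul_le_mul (hM' ?_) (hRle.trans (min_le_left _ _)) hR.le hM0)
        rw [mem_closedBall_zero_iff] at hz
        rw [Metric.mem_closedBall, dist_eq_norm, add_sub_cancel_left, norm_smul, Real.norm_eq_abs,
          abs_of_pos hR]
        have := hRle.trans (min_le_right _ _)
        nlinarith [norm_nonneg z]
    _ = ENNReal.ofReal M * volume (Metric.closedBall (0 : Fin n → ℝ) 3) * ENNReal.ofReal R₁ := by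
        rw [setLIntegral_const]; ring
    _ ≤ _ := hR₁η

lemma exists_integral_cutoff_mul_lap_lt (hP : ConstPhase F)
    (p : Fin n → ℝ) {δ R₀ : ℝ} (hδ : 0 < δ) (hR₀ : 0 < R₀) :
    ∃ R, R₀ ≤ R ∧ R ^ 2 / R ^ n * (∫ x, cutoff 4 ((R ^ 2)⁻¹ * distSq F p x) / 16 *
      lap F (fun y => Real.log (volDensity F y)) x) < δ := by
  have hb : ContDiff ℝ ∞ fun y => Real.log (volDensity F y) :=
    (contDiff_volDensity hF).log fun x => (volDensity_pos hF x).ne'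
  have hb0 (x : Fin n → ℝ) : 0 ≤ Real.log (volDensity F x) := Real.log_nonneg (one_le_volDensity hF x)
  set W := (1 + K ^ 2) ^ n with hW
  have hωW (x : Fin n → ℝ) : volDensity F x ≤ W :=
    (le_self_pow₀ (one_le_volDensity hF x) two_ne_zero).trans (volDensity_sq_le hF hbdd x)
  have hbW (x : Fin n → ℝ) : Real.log (volDensity F x) ≤ W :=
    (Real.log_le_self (volDensity_pos hF x).le).trans (hωW x)
  exact exists_ge_lt_of_hasDerivAt (fun R hR => hasDerivAt_ballMean hF hP hb p hR)
    (fun R hR => le_deriv_ballMean hF hb0 p hR)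
    (fun R hR => ballMean_le hF hb.continuous hb0 hbW hωW p hR) hδ hR₀

end density

section largeScale
variable {n : ℕ} {F : (Fin n → ℝ) → ℝ} (hF : ContDiff ℝ ∞ F) {K : ℝ}
  (hbdd : ∀ x i, |(Hess_isHermitian hF x).eigenvalues i| ≤ K)
include hF

lemma continuous_lap {f : (Fin n → ℝ) → ℝ} (hf : ContDiff ℝ ∞ f) : Continuous (lap F f) := by
  unfold lap
  exact continuous_finsetSum _ fun i _ => continuous_finsetSum _ fun j _ =>
    ((contDiff_volDensity hF).continuous.mul (contDiff_invMetric hF i j).continuous).mul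
      (contDiff_pd (contDiff_pd hf j) i).continuous

lemma smul_norm_fderiv_fderiv_grad_le {R κ : ℝ} (hR : 0 < R) (hκ : 0 < κ) (x : Fin n → ℝ) :
    ‖R • fderiv ℝ (fderiv ℝ (grad F)) x‖ ≤
      n ^ 3 * κ + R ^ 2 / (4 * κ) * ∑ k, ∑ i, ∑ j, mpd k (Hess n F) x i j ^ 2 := by
  have h (a : ℝ) : R * |a| ≤ κ + R ^ 2 / (4 * κ) * a ^ 2 := by
    have e : κ + R ^ 2 / (4 * κ) * a ^ 2 - R * |a| = (R * |a| - 2 * κ) ^ 2 / (4 * κ) := by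
      rw [← sq_abs a]; field_simp; ring
    have : 0 ≤ (R * |a| - 2 * κ) ^ 2 / (4 * κ) := by positivity
    linarith
  calc _ = R * ‖fderiv ℝ (fderiv ℝ (grad F)) x‖ := norm_smul_bilinear hR _
    _ ≤ R * ∑ k, ∑ i, ∑ j, |mpd k (Hess n F) x i j| := by
        gcongr; exact norm_fderiv_fderiv_grad_le hF x
    _ ≤ ∑ k, ∑ i, ∑ j, (κ + R ^ 2 / (4 * κ) * mpd k (Hess n F) x i j ^ 2) := by
        simp only [Finset.mul_sum]
        exact Finset.sum_le_sum fun k _ => Finset.sum_le_sum fun i _ => Finset.sum_le_sum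
          fun j _ => h _
    _ = _ := by
        simp only [Finset.sum_add_distrib, Finset.mul_sum]
        simp
        ring

include hbdd

lemma exists_ge_abs_ballMean_one_sub_le (hP : ConstPhase F) {c : ℝ} (hc : 0 < c)
    (hlap : ∀ x, c * ∑ k, ∑ i, ∑ j, mpd k (Hess n F) x i j ^ 2 ≤
      lap F (fun y => Real.log (volDensity F y)) x)
    (p : Fin n → ℝ) {ε R₀ : ℝ} (hε : 0 < ε) (hR₀ : 0 < R₀) :
    ∃ R, R₀ ≤ R ∧
      |ballMean F p (fun _ => 1) R - ∫ y : Fin n → ℝ, cutoff 3 (∑ k, y k ^ 2)| ≤ ε := by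
  obtain ⟨η, hη, H⟩ := exists_abs_ballMean_one_sub_le hF hbdd hε
  set b : (Fin n → ℝ) → ℝ := fun y => Real.log (volDensity F y) with hbdef
  have hb : ContDiff ℝ ∞ b :=
    (contDiff_volDensity hF).log fun x => (volDensity_pos hF x).ne'
  have hT (x : Fin n → ℝ) : 0 ≤ ∑ k, ∑ i, ∑ j, mpd k (Hess n F) x i j ^ 2 :=
    Finset.sum_nonneg fun k _ => Finset.sum_nonneg fun i _ => Finset.sum_nonneg
      fun j _ => sq_nonneg _
  have hlap0 (x : Fin n → ℝ) : 0 ≤ lap F b x := (mul_nonneg hc.le (hT x)).trans (hlap x)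
  set C : ℝ := n * (n * (n * K)) with hC
  set q : ℝ := n * (1 + C ^ 2) + 1 with hq
  have hq0 : 0 < q := by positivity
  have hdist (x : Fin n → ℝ) : distSq F p x ≤ q * ‖x - p‖ ^ 2 := by
    refine (norm_sq_grad_sub_le hF (norm_fderiv_grad_le hF hbdd) p x).trans ?_
    gcongr
    exact le_add_of_nonneg_right zero_le_one
  set s := √(18 * q) with hs
  have hs0 : 0 < s := Real.sqrt_pos.2 (by positivity)
  have hs2 : s ^ 2 = 18 * q := Real.sq_sqrt (by positivity)
  have hVt : (n ^ 3 : ENNReal) * volume (Metric.closedBall (0 : Fin n → ℝ) 3) ≠ ⊤ :=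
    ENNReal.mul_ne_top (by finiteness) (isCompact_closedBall _ _).measure_ne_top
  obtain ⟨κ, hκ, hκη⟩ := exists_pos_mul_ofReal_le hVt (half_pos hη)
  obtain ⟨ρ, hρ, hA⟩ := exists_integral_cutoff_mul_lap_lt hF hbdd hP p
    (δ := η / 2 * (κ * c * s ^ 2 / (64 * s ^ n))) (R₀ := s * R₀) (by positivity) (by positivity)
  have hρ0 : 0 < ρ := (mul_pos hs0 hR₀).trans_le hρ
  have ha : 0 < (ρ ^ 2)⁻¹ := by positivity
  set Ψ : (Fin n → ℝ) → ℝ := fun x => cutoff 4 ((ρ ^ 2)⁻¹ * distSq F p x) / 16 * lap F b x with hΨ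
  have hΨ0 (x : Fin n → ℝ) : 0 ≤ Ψ x :=
    mul_nonneg (div_nonneg (cutoff_nonneg _ _) (by norm_num)) (hlap0 x)
  have hΨi : Integrable Ψ := by
    refine ((integrable_cutoff_mul hF four_ne_zero ha p (continuous_lap hF hb)).div_const 16).congr
      (Filter.Eventually.of_forall fun x => ?_)
    simp only [hΨ]; ring
  set R := ρ / s with hR
  have hR0 : 0 < R := div_pos hρ0 hs0
  have hρR : ρ = R * s := by rw [hR]; field_simp
  refine ⟨R, by rwa [hR, le_div_iff₀ hs0, mul_comm], H p R hR0 ?_⟩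
  have hpt {z : Fin n → ℝ} (hz : z ∈ Metric.closedBall 0 3) :
      ∑ k, ∑ i, ∑ j, mpd k (Hess n F) (p + R • z) i j ^ 2 ≤ 256 / c * Ψ (p + R • z) := by
    rw [mem_closedBall_zero_iff] at hz
    have hd : distSq F p (p + R • z) ≤ q * (R * 3) ^ 2 := by
      refine (hdist _).trans ?_
      rw [add_sub_cancel_left, norm_smul, Real.norm_eq_abs, abs_of_pos hR0]
      gcongr
    have h1 : (ρ ^ 2)⁻¹ * distSq F p (p + R • z) ≤ 1 / 2 := by
      rw [inv_mul_le_iff₀ (by positivity), hρR, mul_pow, hs2]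
      linarith
    have h2 : 1 / 16 ≤ cutoff 4 ((ρ ^ 2)⁻¹ * distSq F p (p + R • z)) := by
      rw [cutoff]
      calc (1 / 16 : ℝ) = (1 / 2) ^ 4 := by norm_num
        _ ≤ _ := by
          gcongr
          exact le_max_of_le_right (by linarith)
    have h3 : c * ∑ k, ∑ i, ∑ j, mpd k (Hess n F) (p + R • z) i j ^ 2 ≤ 256 * Ψ (p + R • z) := by
      refine (hlap _).trans ?_
      simp only [hΨ]
      have := mul_le_mul_of_nonneg_right h2 (hlap0 (p + R • z))
      linarith
    rw [div_mul_eq_mul_div, le_div_iff₀ hc]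
    linarith
  calc _ ≤ ∫⁻ z in Metric.closedBall 0 3, (ENNReal.ofReal (n ^ 3 * κ) +
          ENNReal.ofReal (R ^ 2 / (4 * κ) * (256 / c) * Ψ (p + R • z))) := by
        refine setLIntegral_mono' Metric.isClosed_closedBall.measurableSet fun z hz => ?_
        rw [← ofReal_norm, ← ENNReal.ofReal_add (by positivity)
          (mul_nonneg (by positivity) (hΨ0 _)), mul_assoc]
        refine ENNReal.ofReal_le_ofReal ((smul_norm_fderiv_fderiv_grad_le hF hR0 hκ _).trans ?_)
        gcongr
        exact hpt hz
    _ ≤ ENNReal.ofReal (n ^ 3 * κ) * volume (Metric.closedBall (0 : Fin n → ℝ) 3) +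
          ∫⁻ z, ENNReal.ofReal (R ^ 2 / (4 * κ) * (256 / c) * Ψ (p + R • z)) := by
        rw [lintegral_add_left measurable_const, setLIntegral_const]
        gcongr
        exact Measure.restrict_le_self
    _ ≤ ENNReal.ofReal (η / 2) + ENNReal.ofReal (η / 2) := by
        refine add_le_add (le_trans (le_of_eq ?_) hκη) ?_
        · rw [ENNReal.ofReal_mul (by positivity), ENNReal.ofReal_pow (by positivity),
            ENNReal.ofReal_natCast]
          ring
        · rw [← ofReal_integral_eq_lintegral_ofReal
            (((hΨi.comp_add_left p).comp_smul hR0.ne').const_mul _)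
            (Filter.Eventually.of_forall fun z => mul_nonneg (by positivity) (hΨ0 _))]
          refine ENNReal.ofReal_le_ofReal ?_
          rw [integral_const_mul, integral_comp_add_smul Ψ p hR0]
          have e : R ^ 2 / (4 * κ) * (256 / c) * ((∫ x, Ψ x) / R ^ n) =
              (ρ ^ 2 / ρ ^ n * ∫ x, Ψ x) / (κ * c * s ^ 2 / (64 * s ^ n)) := by
            rw [hR]; simp only [div_pow]; field_simp; ring
          rw [e, div_le_iff₀ (by positivity)]
          exact hA.le
    _ = ENNReal.ofReal η := by
        rw [← ENNReal.ofReal_add (by positivity) (by positivity), add_halves]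

end largeScale

lemma constPhase_of_sum_arctan {n : ℕ} {F : (Fin n → ℝ) → ℝ}
    (hsymm : ∀ x, (Hess n F x).IsHermitian) {Θ : ℝ}
    (hSLE : ∀ x, ∑ i, Real.arctan ((hsymm x).eigenvalues i) = Θ) : ConstPhase F :=
  ⟨Θ, fun x => by rw [det_one_add_I_smul (hsymm x), hSLE x, volDensity]⟩

lemma ballMean_one_eq_integral_cutoff {n : ℕ} {F : (Fin n → ℝ) → ℝ} (hF : ContDiff ℝ ∞ F) {K : ℝ}
    (hbdd : ∀ x i, |(Hess_isHermitian hF x).eigenvalues i| ≤ K) (hP : ConstPhase F)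
    {c : ℝ} (hc : 0 < c)
    (hlap : ∀ x, c * ∑ k, ∑ i, ∑ j, mpd k (Hess n F) x i j ^ 2 ≤
      lap F (fun y => Real.log (volDensity F y)) x)
    (p : Fin n → ℝ) {R : ℝ} (hR : 0 < R) :
    ballMean F p (fun _ => 1) R = ∫ y : Fin n → ℝ, cutoff 3 (∑ k, y k ^ 2) := by
  have hmono := monotoneOn_ballMean_one hF hP p
  refine le_antisymm (le_of_forall_pos_le_add fun ε hε => ?_)
    (le_of_forall_pos_le_add fun ε hε => ?_)
  · obtain ⟨S, hS, h⟩ := exists_ge_abs_ballMean_one_sub_le hF hbdd hP hc hlap p hε hR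
    have h1 := hmono hR (hR.trans_le hS) hS
    linarith [(abs_le.1 h).2]
  · obtain ⟨S, hS, h⟩ := exists_abs_ballMean_one_sub_le_of_le hF hbdd p hε
    have hm : 0 < min S R := lt_min hS hR
    have h1 := hmono hm hR (min_le_right S R)
    linarith [(abs_le.1 (h _ hm (min_le_left S R))).1]

end specialLagrangian

/-- **Theorem A (graphical form).** If `F : ℝⁿ → ℝ` is a smooth entire solution of the
special Lagrangian equation `∑ᵢ arctan λᵢ(x) = Θ`, where `λᵢ(x)` are the eigenvalues of
the Hessian `D²F(x)`, and at every point the eigenvalues satisfy `λᵢ λⱼ ≥ -1` and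
`|λᵢ| ≤ K`, then `D²F` is constant (so `F` is a quadratic polynomial and the graph of
`∇F` is an affine subspace of `ℝ²ⁿ`). -/
theorem bernstein_special_lagrangian_eigenvalue_product_bound
    (n : ℕ) (hn : 1 ≤ n) (K : ℝ) (hK : 0 < K)
    (F : (Fin n → ℝ) → ℝ) (hF : ContDiff ℝ (⊤ : ℕ∞) F)
    (hsymm : ∀ x, (Hess n F x).IsHermitian)
    (Θ : ℝ)
    (hSLE : ∀ x, ∑ i, Real.arctan ((hsymm x).eigenvalues i) = Θ)
    (hprod : ∀ x, ∀ i j, -1 ≤ (hsymm x).eigenvalues i * (hsymm x).eigenvalues j)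
    (hbdd : ∀ x, ∀ i, |(hsymm x).eigenvalues i| ≤ K) :
    ∀ x y, Hess n F x = Hess n F y := by
  have hP := constPhase_of_sum_arctan hsymm hSLE
  refine Hess_eq_of_ballMean_eqOn hF hP (c := fun _ => ∫ y : Fin n → ℝ, cutoff 3 (∑ k, y k ^ 2))
    fun p R hR => ballMean_one_eq_integral_cutoff hF hbdd hP (c := 1 / 3 * (1 / (1 + K ^ 2)) ^ 3)
      (by positivity) (fun x => le_lap_log_volDensity hF hP x (hprod x) (hbdd x)) p hR
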